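/- arXiv:1907.06054 — 2 statements merged into one kernel-verified Lean document; each statement's English description precedes it below -/
import Mathlib

section
/- There exists a constant C > 0 such that the following holds. Let Y₁, …, Y_n be i.i.d. χ²₁ random variables with order statistics Y₍₁₎ ≥ … ≥ Y₍ₙ₎, let k satisfy k/n < 1/5, define T_k = √((1/k)·Σ_{i=1}^k Y₍ᵢ₎), let t be defined by P(Y₁ > t) = k/n, and set T = √(E(Y₁ | Y₁ > t)). Then |E(T_k) − T| ≤ C/√(k·log(n/k)). -/
open MeasureTheory ProbabilityTheory

/-- The χ²₁ distribution: law of the square of a standard Gaussian. -/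
noncomputable def chiSq1 : Measure ℝ := (gaussianReal 0 1).map (· ^ 2)

/-- Conditional expectation `E(Y | Y > t)` for `Y ~ chiSq1`. -/
noncomputable def condExpGt (t : ℝ) : ℝ :=
  (∫ y in Set.Ioi t, y ∂chiSq1) / (chiSq1 (Set.Ioi t)).toReal

/-- Sum of the top `k` order statistics `Y_(1) + ⋯ + Y_(k)` of `Y : Fin n → ℝ`
(for nonnegative `Y` and `k ≤ n`), realized as the largest sum over index sets of size `k`. -/
noncomputable def topSum (n k : ℕ) (Y : Fin n → ℝ) : ℝ :=
  sSup ((fun S : Finset (Fin n) => ∑ i ∈ S, Y i) '' {S | S.card = k})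

open Set

instance instIsProbabilityMeasureChiSq1 : IsProbabilityMeasure chiSq1 :=
  Measure.isProbabilityMeasure_map (by fun_prop)

lemma ae_nonneg_chiSq1 : ∀ᵐ y ∂chiSq1, 0 ≤ y := by
  rw [chiSq1, ae_map_iff (by fun_prop) measurableSet_Ici]
  exact .of_forall fun x => sq_nonneg x

lemma integrable_id_chiSq1 : Integrable (fun y => y) chiSq1 := by
  rw [chiSq1, integrable_map_measure (by fun_prop) (by fun_prop)]
  exact (memLp_id_gaussianReal (μ := 0) (v := 1) 2).integrable_sq

lemma gaussianPDFReal_std (x : ℝ) :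
    gaussianPDFReal 0 1 x = (√(2 * Real.pi))⁻¹ * Real.exp (-x ^ 2 / 2) := by
  simp [gaussianPDFReal]

lemma chiSq1_Ioi {s : ℝ} (hs : 0 ≤ s) :
    chiSq1 (Ioi s) = 2 * gaussianReal 0 1 (Ioi (√s)) := by
  have hneg : gaussianReal 0 1 (Iio (-√s)) = gaussianReal 0 1 (Ioi (√s)) := by
    conv_lhs => rw [← neg_zero, ← gaussianReal_map_neg (μ := 0) (v := 1)]
    rw [Measure.map_apply (by fun_prop) measurableSet_Iio]
    congr 1
    ext x
    simp
  have hset : (fun x : ℝ => x ^ 2) ⁻¹' Ioi s = Ioi (√s) ∪ Iio (-√s) := by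
    ext x
    simp only [mem_preimage, mem_Ioi, mem_union, mem_Iio]
    rw [← Real.sqrt_lt_sqrt_iff hs, Real.sqrt_sq_eq_abs, lt_abs, lt_neg]
  rw [chiSq1, Measure.map_apply (by fun_prop) measurableSet_Ioi, hset,
    measure_union _ measurableSet_Iio, hneg, two_mul]
  refine Set.disjoint_left.2 fun x hx hx' => ?_
  have := Real.sqrt_nonneg s
  simp only [mem_Ioi, mem_Iio] at hx hx'
  linarith

lemma gaussianReal_Ioi_sqrt_add_le {s x : ℝ} (hs : 0 ≤ s) (hx : 0 ≤ x) :
    gaussianReal 0 1 (Ioi (√(s + x))) ≤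
      ENNReal.ofReal (Real.exp (-x / 2)) * gaussianReal 0 1 (Ioi (√s)) := by
  have hpos : ∀ v ∈ Ioi (√s), 0 < v := fun v hv => (Real.sqrt_nonneg s).trans_lt hv
  have himg : Ioi (√(s + x)) ⊆ (fun v => √(v ^ 2 + x)) '' Ioi (√s) := by
    intro u hu
    have hu0 : 0 < u := (Real.sqrt_nonneg _).trans_lt hu
    have hu2 : s + x < u ^ 2 := (Real.sqrt_lt' hu0).1 hu
    refine ⟨√(u ^ 2 - x), Real.sqrt_lt_sqrt hs (by linarith), ?_⟩
    dsimp only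
    rw [Real.sq_sqrt (by linarith), sub_add_cancel, Real.sqrt_sq hu0.le]
  have hderiv : ∀ v ∈ Ioi (√s), HasDerivWithinAt (fun v => √(v ^ 2 + x))
      (v / √(v ^ 2 + x)) (Ioi (√s)) v := by
    intro v hv
    have h0 : v ^ 2 + x ≠ 0 := by have := hpos v hv; positivity
    have h1 : HasDerivAt (fun v : ℝ => v ^ 2 + x) (2 * v) v := by
      simpa using (hasDerivAt_pow 2 v).add_const x
    convert! (h1.sqrt h0).hasDerivWithinAt using 1
    field_simp
  have hinj : InjOn (fun v => √(v ^ 2 + x)) (Ioi (√s)) := by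
    intro v hv w hw h
    have hv0 := hpos v hv
    have hw0 := hpos w hw
    have h2 : v ^ 2 + x = w ^ 2 + x :=
      (Real.sqrt_inj (by positivity) (by positivity)).1 h
    exact (sq_eq_sq₀ hv0.le hw0.le).1 (by linarith)
  refine (measure_mono himg).trans ?_
  rw [gaussianReal_apply 0 one_ne_zero, gaussianReal_apply 0 one_ne_zero,
    lintegral_image_eq_lintegral_abs_deriv_mul measurableSet_Ioi hderiv hinj,
    ← lintegral_const_mul _ (measurable_gaussianPDF 0 1)]
  refine setLIntegral_mono ((measurable_gaussianPDF 0 1).const_mul _) fun v hv => ?_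
  have hv0 := hpos v hv
  have hle : |v / √(v ^ 2 + x)| ≤ 1 := by
    rw [abs_of_nonneg (by positivity)]
    exact div_le_one_of_le₀ (Real.le_sqrt_of_sq_le (by linarith)) (Real.sqrt_nonneg _)
  have hpdf : gaussianPDFReal 0 1 (√(v ^ 2 + x)) =
      Real.exp (-x / 2) * gaussianPDFReal 0 1 v := by
    rw [gaussianPDFReal_std, gaussianPDFReal_std, Real.sq_sqrt (by positivity),
      mul_left_comm, ← Real.exp_add]
    ring_nf
  rw [gaussianPDF, hpdf, ENNReal.ofReal_mul (Real.exp_pos _).le]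
  exact mul_le_of_le_one_left' (ENNReal.ofReal_le_one.2 hle)

/-- The hazard rate of the `χ²₁` law is at least `1/2`. -/
lemma chiSq1_real_Ioi_add_le {s x : ℝ} (hs : 0 ≤ s) (hx : 0 ≤ x) :
    chiSq1.real (Ioi (s + x)) ≤ Real.exp (-x / 2) * chiSq1.real (Ioi s) := by
  rw [measureReal_def, measureReal_def, chiSq1_Ioi (by positivity), chiSq1_Ioi hs,
    ← ENNReal.toReal_ofReal (Real.exp_pos (-x / 2)).le, ← ENNReal.toReal_mul]
  refine ENNReal.toReal_mono (by finiteness) ?_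
  rw [mul_left_comm]
  gcongr
  exact gaussianReal_Ioi_sqrt_add_le hs hx

lemma exp_neg_le_chiSq1_real_Ioi {t : ℝ} (ht : 0 ≤ t) :
    Real.exp (-(t + 2)) ≤ chiSq1.real (Ioi t) := by
  have hpi : √(2 * Real.pi) ≤ Real.exp 1 := by
    refine Real.sqrt_le_iff.2 ⟨(Real.exp_pos _).le, ?_⟩
    have := Real.pi_lt_d2
    have := Real.exp_one_gt_d9
    nlinarith
  have hpi0 : 0 < √(2 * Real.pi) := by positivity
  have hbound : ∀ v ∈ Ioc (√t) (√t + 1),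
      ENNReal.ofReal (Real.exp (-(t + 2))) ≤ gaussianPDF 0 1 v := by
    intro v hv
    have h0 := Real.sqrt_nonneg t
    refine ENNReal.ofReal_le_ofReal ?_
    rw [gaussianPDFReal_std]
    calc Real.exp (-(t + 2)) = (Real.exp 1)⁻¹ * Real.exp (-(t + 1)) := by
          rw [← Real.exp_neg, ← Real.exp_add]; ring_nf
      _ ≤ _ := by
          have h1 : v ^ 2 ≤ (√t + 1) ^ 2 := pow_le_pow_left₀ (h0.trans hv.1.le) hv.2 2
          have h2 := Real.sq_sqrt ht
          gcongr
          nlinarith [sq_nonneg (√t - 1)]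
  have h : ENNReal.ofReal (Real.exp (-(t + 2))) ≤ chiSq1 (Ioi t) := by
    calc ENNReal.ofReal (Real.exp (-(t + 2)))
        = ∫⁻ _ in Ioc (√t) (√t + 1), ENNReal.ofReal (Real.exp (-(t + 2))) := by simp
      _ ≤ gaussianReal 0 1 (Ioc (√t) (√t + 1)) := by
          rw [gaussianReal_apply 0 one_ne_zero]
          exact setLIntegral_mono (measurable_gaussianPDF 0 1) hbound
      _ ≤ gaussianReal 0 1 (Ioi (√t)) := measure_mono Ioc_subset_Ioi_self
      _ ≤ chiSq1 (Ioi t) := by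
          rw [chiSq1_Ioi ht, two_mul]
          exact le_self_add
  exact (ENNReal.ofReal_le_iff_le_toReal (by finiteness)).1 h

lemma half_le_chiSq1_real_Ioi : 1 / 2 ≤ chiSq1.real (Ioi (1 / 4)) := by
  have hcompl : chiSq1.real (Ioi (1 / 4)) = 1 - chiSq1.real (Iic (1 / 4)) := by
    rw [← compl_Iic, probReal_compl_eq_one_sub measurableSet_Iic]
  have hpdf : ∀ v, gaussianPDF 0 1 v ≤ ENNReal.ofReal (1 / 2) := by
    intro v
    refine ENNReal.ofReal_le_ofReal ?_
    rw [gaussianPDFReal_std]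
    have h2 : (2 : ℝ) ≤ √(2 * Real.pi) := by
      refine Real.le_sqrt_of_sq_le ?_
      have := Real.pi_gt_three
      linarith
    have h3 : Real.exp (-v ^ 2 / 2) ≤ 1 := Real.exp_le_one_iff.2 (by nlinarith [sq_nonneg v])
    calc (√(2 * Real.pi))⁻¹ * Real.exp (-v ^ 2 / 2) ≤ (2 : ℝ)⁻¹ * 1 := by gcongr
      _ = 1 / 2 := by norm_num
  have hle : chiSq1 (Iic (1 / 4)) ≤ ENNReal.ofReal (1 / 2) := by
    rw [chiSq1, Measure.map_apply (by fun_prop) measurableSet_Iic]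
    calc gaussianReal 0 1 ((fun x : ℝ => x ^ 2) ⁻¹' Iic (1 / 4))
        ≤ gaussianReal 0 1 (Icc (-(1 / 2)) (1 / 2)) := by
          refine measure_mono fun x hx => ?_
          have hx' : x ^ 2 ≤ 1 / 4 := hx
          exact ⟨by nlinarith, by nlinarith⟩
      _ ≤ ∫⁻ _ in Icc (-(1 / 2) : ℝ) (1 / 2), ENNReal.ofReal (1 / 2) := by
          rw [gaussianReal_apply 0 one_ne_zero]
          exact lintegral_mono fun v => hpdf v
      _ = ENNReal.ofReal (1 / 2) := by simp; norm_num
  have := ENNReal.toReal_mono (by finiteness) hle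
  rw [ENNReal.toReal_ofReal (by norm_num)] at this
  rw [hcompl, measureReal_def]
  linarith

/-- The number of coordinates of `Y` exceeding `u`, as a real number. -/
noncomputable def tailCount {n : ℕ} (Y : Fin n → ℝ) (u : ℝ) : ℝ :=
  ∑ i, (Ioi u).indicator 1 (Y i)

lemma measurable_uncurry_tailCount {n : ℕ} :
    Measurable fun p : (Fin n → ℝ) × ℝ => tailCount p.1 p.2 := by
  unfold tailCount
  refine Finset.measurable_sum _ fun i _ => ?_
  have : (fun p : (Fin n → ℝ) × ℝ => (Ioi p.2).indicator (1 : ℝ → ℝ) (p.1 i)) =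
      {p : (Fin n → ℝ) × ℝ | p.2 < p.1 i}.indicator 1 := by
    ext p
    simp [indicator]
  rw [this]
  exact measurable_one.indicator (measurableSet_lt (by fun_prop) (by fun_prop))

lemma measurable_tailCount {n : ℕ} (u : ℝ) : Measurable fun Y : Fin n → ℝ => tailCount Y u :=
  measurable_uncurry_tailCount.comp measurable_prodMk_right

lemma measurable_tailCount_right {n : ℕ} (Y : Fin n → ℝ) : Measurable (tailCount Y) :=
  measurable_uncurry_tailCount.comp measurable_prodMk_left

lemma memLp_tailCount {n : ℕ} (u : ℝ) :
    MemLp (fun Y : Fin n → ℝ => tailCount Y u) 2 (Measure.pi fun _ => chiSq1) := by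
  refine memLp_finsetSum _ fun i _ => ?_
  have h : MemLp ((Ioi u).indicator (1 : ℝ → ℝ)) 2 chiSq1 :=
    (memLp_const (1 : ℝ)).indicator measurableSet_Ioi
  exact h.comp_measurePreserving (measurePreserving_eval (fun _ : Fin n => chiSq1) i)

lemma integral_tailCount {n : ℕ} (u : ℝ) :
    ∫ Y : Fin n → ℝ, tailCount Y u ∂(Measure.pi fun _ => chiSq1) =
      n * chiSq1.real (Ioi u) := by
  unfold tailCount
  have h : Integrable ((Ioi u).indicator (1 : ℝ → ℝ)) chiSq1 :=
    (integrable_const (1 : ℝ)).indicator measurableSet_Ioi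
  rw [integral_finsetSum _ fun i _ => integrable_comp_eval h]
  have hi (i : Fin n) : ∫ Y : Fin n → ℝ, (Ioi u).indicator (1 : ℝ → ℝ) (Y i)
      ∂(Measure.pi fun _ => chiSq1) = chiSq1.real (Ioi u) := by
    rw [integral_comp_eval (μ := fun _ : Fin n => chiSq1) h.aestronglyMeasurable,
      integral_indicator_one measurableSet_Ioi]
  simp [hi]

lemma variance_tailCount_le {n : ℕ} (u : ℝ) :
    Var[fun Y : Fin n → ℝ => tailCount Y u; Measure.pi fun _ => chiSq1] ≤
      n * chiSq1.real (Ioi u) := by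
  have h : MemLp ((Ioi u).indicator (1 : ℝ → ℝ)) 2 chiSq1 :=
    (memLp_const (1 : ℝ)).indicator measurableSet_Ioi
  have heq : (fun Y : Fin n → ℝ => tailCount Y u) =
      ∑ i, fun Y : Fin n → ℝ => (Ioi u).indicator (1 : ℝ → ℝ) (Y i) := by
    ext Y
    simp [tailCount]
  rw [heq, variance_sum_pi fun _ => h]
  simp only [Finset.sum_const, Finset.card_univ, Fintype.card_fin, nsmul_eq_mul]
  gcongr
  refine (variance_le_expectation_sq h.aestronglyMeasurable).trans_eq ?_
  rw [← integral_indicator_one measurableSet_Ioi]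
  congr 1
  ext y
  by_cases hy : y ∈ Ioi u <;> simp [hy]

lemma lintegral_abs_tailCount_sub_le {n : ℕ} (u : ℝ) :
    ∫⁻ Y : Fin n → ℝ, ENNReal.ofReal |tailCount Y u - n * chiSq1.real (Ioi u)|
        ∂(Measure.pi fun _ => chiSq1) ≤
      ENNReal.ofReal (√(n * chiSq1.real (Ioi u))) := by
  have hL := memLp_tailCount (n := n) u
  have hsub := hL.sub (memLp_const (n * chiSq1.real (Ioi u)))
  have hint : Integrable (fun Y : Fin n → ℝ => |tailCount Y u - n * chiSq1.real (Ioi u)|)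
      (Measure.pi fun _ => chiSq1) := (hsub.integrable (by norm_num)).abs
  have hvar := variance_eq_integral hL.aestronglyMeasurable.aemeasurable
  rw [integral_tailCount] at hvar
  have habs := variance_nonneg (fun Y : Fin n → ℝ =>
    |tailCount Y u - n * chiSq1.real (Ioi u)|) (Measure.pi fun _ => chiSq1)
  have habsLp : MemLp (fun Y : Fin n → ℝ => |tailCount Y u - n * chiSq1.real (Ioi u)|) 2
      (Measure.pi fun _ => chiSq1) := hsub.abs
  rw [variance_eq_sub habsLp] at habs
  simp only [Pi.pow_apply, sq_abs] at habs
  rw [← hvar] at habs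
  rw [← ofReal_integral_eq_lintegral_ofReal hint (.of_forall fun _ => abs_nonneg _)]
  refine ENNReal.ofReal_le_ofReal (Real.le_sqrt_of_sq_le ?_)
  have := variance_tailCount_le (n := n) u
  linarith

lemma integral_exp_neg_tailCount_le {n : ℕ} (u : ℝ) {l : ℝ} (hl : 0 ≤ l) :
    ∫ Y : Fin n → ℝ, Real.exp (-(l * tailCount Y u)) ∂(Measure.pi fun _ => chiSq1) ≤
      Real.exp (-(n * chiSq1.real (Ioi u) * (l / (1 + l)))) := by
  have hprod : ∀ Y : Fin n → ℝ, Real.exp (-(l * tailCount Y u)) =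
      ∏ i, (1 - (1 - Real.exp (-l)) * (Ioi u).indicator (1 : ℝ → ℝ) (Y i)) := by
    intro Y
    rw [tailCount, Finset.mul_sum, ← Finset.sum_neg_distrib, Real.exp_sum]
    refine Finset.prod_congr rfl fun i _ => ?_
    by_cases hy : Y i ∈ Ioi u <;> simp [hy]
  simp_rw [hprod]
  rw [integral_fintype_prod_eq_pow (fun y => 1 - (1 - Real.exp (-l)) *
    (Ioi u).indicator (1 : ℝ → ℝ) y), Fintype.card_fin]
  have h : Integrable ((Ioi u).indicator (1 : ℝ → ℝ)) chiSq1 :=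
    (integrable_const (1 : ℝ)).indicator measurableSet_Ioi
  rw [integral_sub (integrable_const _) (h.const_mul _), integral_const_mul,
    integral_indicator_one measurableSet_Ioi]
  have hp : chiSq1.real (Ioi u) ≤ 1 := measureReal_le_one
  have hp0 : 0 ≤ chiSq1.real (Ioi u) := measureReal_nonneg
  have he : l / (1 + l) ≤ 1 - Real.exp (-l) := by
    rw [Real.exp_neg, div_le_iff₀ (by positivity)]
    have h1 := Real.add_one_le_exp l
    have h2 : (Real.exp l)⁻¹ * (1 + l) ≤ 1 := by
      rw [inv_mul_le_iff₀ (Real.exp_pos _)]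
      linarith
    linarith
  have he1 : 0 ≤ 1 - Real.exp (-l) := (by positivity : 0 ≤ l / (1 + l)).trans he
  simp only [integral_const, probReal_univ, one_smul]
  calc (1 - (1 - Real.exp (-l)) * chiSq1.real (Ioi u)) ^ n
      ≤ Real.exp (-(l / (1 + l) * chiSq1.real (Ioi u))) ^ n := by
        refine pow_le_pow_left₀ ?_ ?_ n
        · have := Real.exp_pos (-l)
          nlinarith
        · refine le_trans ?_ (Real.add_one_le_exp _)
          nlinarith
    _ = _ := by
        rw [← Real.exp_nat_mul]
        ring_nf

lemma lintegral_sub_tailCount_le {n k : ℕ} (hk : 0 < k) (u : ℝ) {r : ℝ} (hr : 1 ≤ r)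
    (h : k * r ≤ n * chiSq1.real (Ioi u)) :
    ∫⁻ Y : Fin n → ℝ, ENNReal.ofReal (k - tailCount Y u) ∂(Measure.pi fun _ => chiSq1) ≤
      ENNReal.ofReal (2 * √k * Real.exp (-(r / 4))) := by
  have hk1 : (1 : ℝ) ≤ k := by exact_mod_cast hk
  have hq1 : 1 ≤ √(k : ℝ) := Real.one_le_sqrt.2 hk1
  set q := √(k : ℝ) with hq
  have hqk : (k : ℝ) = q ^ 2 := (Real.sq_sqrt (by positivity)).symm
  have hq0 : 0 < q := by linarith
  set l := 1 / (2 * q) with hl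
  have hl0 : 0 < l := by positivity
  have hlq : l * q = 1 / 2 := by rw [hl]; field_simp
  have hmono : ∀ Y : Fin n → ℝ, (k : ℝ) - tailCount Y u ≤
      2 * q * Real.exp (l * k - 1) * Real.exp (-(l * tailCount Y u)) := by
    intro Y
    have h1 := Real.add_one_le_exp (l * k - 1 + -(l * tailCount Y u))
    rw [mul_assoc, ← Real.exp_add]
    calc (k : ℝ) - tailCount Y u = 2 * q * (l * k - l * tailCount Y u) := by
          linear_combination (-2 * (k - tailCount Y u)) * hlq
      _ ≤ _ := by gcongr; linarith
  have hnn : ∀ Y : Fin n → ℝ, 0 ≤ tailCount Y u := fun Y =>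
    Finset.sum_nonneg fun i _ => indicator_nonneg (fun _ _ => zero_le_one) _
  have hint : Integrable (fun Y : Fin n → ℝ => Real.exp (-(l * tailCount Y u)))
      (Measure.pi fun _ => chiSq1) := by
    refine Integrable.of_bound (C := 1) ?_ (.of_forall fun Y => ?_)
    · exact ((measurable_tailCount u).const_mul l).neg.exp.aestronglyMeasurable
    · rw [Real.norm_eq_abs, Real.abs_exp]
      exact Real.exp_le_one_iff.2 (neg_nonpos.2 (mul_nonneg hl0.le (hnn Y)))
  calc ∫⁻ Y : Fin n → ℝ, ENNReal.ofReal (k - tailCount Y u) ∂(Measure.pi fun _ => chiSq1)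
      ≤ ∫⁻ Y : Fin n → ℝ, ENNReal.ofReal
          (2 * q * Real.exp (l * k - 1) * Real.exp (-(l * tailCount Y u)))
          ∂(Measure.pi fun _ => chiSq1) :=
        lintegral_mono fun Y => ENNReal.ofReal_le_ofReal (hmono Y)
    _ = ENNReal.ofReal (2 * q * Real.exp (l * k - 1) *
          ∫ Y : Fin n → ℝ, Real.exp (-(l * tailCount Y u)) ∂(Measure.pi fun _ => chiSq1)) := by
        rw [← integral_const_mul, ofReal_integral_eq_lintegral_ofReal (hint.const_mul _)]
        exact .of_forall fun Y => by positivity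
    _ ≤ _ := by
        refine ENNReal.ofReal_le_ofReal ?_
        rw [mul_assoc]
        refine mul_le_mul_of_nonneg_left ?_ (by positivity)
        calc Real.exp (l * k - 1) *
              ∫ Y : Fin n → ℝ, Real.exp (-(l * tailCount Y u)) ∂(Measure.pi fun _ => chiSq1)
            ≤ Real.exp (l * k - 1) *
              Real.exp (-(n * chiSq1.real (Ioi u) * (l / (1 + l)))) := by
              gcongr
              exact integral_exp_neg_tailCount_le u hl0.le
          _ ≤ Real.exp (-(r / 4)) := by
              rw [← Real.exp_add, Real.exp_le_exp]
              have h1 : l - l ^ 2 ≤ l / (1 + l) := by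
                rw [le_div_iff₀ (by positivity)]
                nlinarith [pow_pos hl0 3]
              have h2 : k * r * (l - l ^ 2) ≤ n * chiSq1.real (Ioi u) * (l / (1 + l)) := by
                have : 0 ≤ l / (1 + l) := by positivity
                have : (0 : ℝ) ≤ k * r := by positivity
                nlinarith
              have h3 : k * r * (l - l ^ 2) = r * (q / 2 - 1 / 4) := by
                rw [hqk]
                linear_combination (r * q - r * (l * q + 1 / 2)) * hlq
              have h4 : l * k = q / 2 := by
                rw [hqk]
                linear_combination q * hlq
              rw [h3] at h2
              rw [h4]
              nlinarith

lemma topSum_eq_sup' {n k : ℕ} (hkn : k ≤ n) (Y : Fin n → ℝ) :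
    topSum n k Y = (Finset.powersetCard k (Finset.univ : Finset (Fin n))).sup'
      (Finset.powersetCard_nonempty.2 (by simpa using hkn)) (fun S => ∑ i ∈ S, Y i) := by
  rw [Finset.sup'_eq_csSup_image, topSum]
  congr 2
  ext S
  simp [Finset.mem_powersetCard]

lemma measurable_topSum {n k : ℕ} (hkn : k ≤ n) : Measurable (topSum n k) := by
  have : topSum n k = fun Y => (Finset.powersetCard k (Finset.univ : Finset (Fin n))).sup'
      (Finset.powersetCard_nonempty.2 (by simpa using hkn)) (fun S => ∑ i ∈ S, Y i) :=
    funext (topSum_eq_sup' hkn)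
  rw [this]
  have h := Finset.measurable_sup' (s := Finset.powersetCard k (Finset.univ : Finset (Fin n)))
    (f := fun S (Y : Fin n → ℝ) => ∑ i ∈ S, Y i)
    (Finset.powersetCard_nonempty.2 (by simpa using hkn)) fun S _ => by fun_prop
  convert h using 1
  ext Y
  rw [Finset.sup'_apply]

/-- The top-`k` sum is bounded by `k s + ∑ (Y i - s)⁺` for every level `s`. -/
lemma topSum_le {n k : ℕ} (hkn : k ≤ n) (Y : Fin n → ℝ) (s : ℝ) :
    topSum n k Y ≤ k * s + ∑ i, max (Y i - s) 0 := by
  rw [topSum_eq_sup' hkn]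
  refine Finset.sup'_le _ _ fun S hS => ?_
  have hcard : S.card = k := (Finset.mem_powersetCard.1 hS).2
  have h1 : ∑ i ∈ S, Y i = k * s + ∑ i ∈ S, (Y i - s) := by
    rw [Finset.sum_sub_distrib, Finset.sum_const, hcard, nsmul_eq_mul]
    ring
  have h2 : ∑ i ∈ S, (Y i - s) ≤ ∑ i ∈ S, max (Y i - s) 0 :=
    Finset.sum_le_sum fun i _ => le_max_left _ _
  have h3 : ∑ i ∈ S, max (Y i - s) 0 ≤ ∑ i, max (Y i - s) 0 :=
    Finset.sum_le_sum_of_subset_of_nonneg (Finset.subset_univ S) fun i _ _ => le_max_right _ _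
  linarith

/-- The bound `topSum_le` is attained at the `k`-th largest coordinate. -/
lemma exists_topSum_eq {n k : ℕ} (hk : 0 < k) (hkn : k ≤ n) (Y : Fin n → ℝ) :
    ∃ j, topSum n k Y = k * Y j + ∑ i, max (Y i - Y j) 0 := by
  classical
  obtain ⟨S, hS, hmax⟩ := Finset.exists_max_image
    (Finset.powersetCard k (Finset.univ : Finset (Fin n))) (fun S => ∑ i ∈ S, Y i)
    (Finset.powersetCard_nonempty.2 (by simpa using hkn))
  have hcard : S.card = k := (Finset.mem_powersetCard.1 hS).2
  obtain ⟨j, hjS, hmin⟩ := Finset.exists_min_image S Y (Finset.card_pos.1 (by omega))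
  have hout : ∀ i ∉ S, Y i ≤ Y j := by
    intro i hi
    have hi' : i ∉ S.erase j := fun h => hi (Finset.mem_of_mem_erase h)
    have h := hmax (insert i (S.erase j)) (by
      simp only [Finset.mem_powersetCard, Finset.subset_univ, true_and]
      rw [Finset.card_insert_of_notMem hi', Finset.card_erase_of_mem hjS]
      omega)
    rw [Finset.sum_insert hi', ← Finset.add_sum_erase S Y hjS] at h
    linarith
  refine ⟨j, ?_⟩
  have htop : topSum n k Y = ∑ i ∈ S, Y i := by
    rw [topSum_eq_sup' hkn]
    exact le_antisymm (Finset.sup'_le _ _ hmax) (Finset.le_sup' (fun S => ∑ i ∈ S, Y i) hS)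
  have h1 : ∑ i, max (Y i - Y j) 0 = ∑ i ∈ S, (Y i - Y j) := by
    rw [← Finset.sum_subset (Finset.subset_univ S) fun i _ hi =>
      max_eq_right (sub_nonpos.2 (hout i hi))]
    exact Finset.sum_congr rfl fun i hi => max_eq_left (sub_nonneg.2 (hmin i hi))
  rw [htop, h1, Finset.sum_sub_distrib, Finset.sum_const, hcard, nsmul_eq_mul]
  ring

lemma indicator_Ioi_one_comm (u y : ℝ) :
    (Ioi u).indicator (1 : ℝ → ℝ) y = (Iio y).indicator 1 u := by
  simp [indicator]

lemma integrableOn_indicator_Ioi (s y : ℝ) :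
    IntegrableOn (fun u => (Ioi u).indicator (1 : ℝ → ℝ) y) (Ioi s) := by
  simp_rw [indicator_Ioi_one_comm]
  rw [IntegrableOn, integrable_indicator_iff measurableSet_Iio, IntegrableOn,
    Measure.restrict_restrict measurableSet_Iio]
  refine integrableOn_const ?_
  rw [inter_comm, Ioi_inter_Iio]
  exact measure_Ioo_lt_top.ne

lemma setIntegral_indicator_Ioi (s y : ℝ) :
    ∫ u in Ioi s, (Ioi u).indicator (1 : ℝ → ℝ) y = max (y - s) 0 := by
  simp_rw [indicator_Ioi_one_comm]
  rw [integral_indicator_one measurableSet_Iio, measureReal_restrict_apply measurableSet_Iio,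
    inter_comm, Ioi_inter_Iio, measureReal_def, Real.volume_Ioo, ENNReal.toReal_ofReal']

lemma integrableOn_tailCount {n : ℕ} (Y : Fin n → ℝ) (s : ℝ) :
    IntegrableOn (tailCount Y) (Ioi s) :=
  integrable_finsetSum _ fun i _ => integrableOn_indicator_Ioi s (Y i)

lemma setIntegral_tailCount {n : ℕ} (Y : Fin n → ℝ) (s : ℝ) :
    ∫ u in Ioi s, tailCount Y u = ∑ i, max (Y i - s) 0 := by
  unfold tailCount
  rw [integral_finsetSum _ fun i _ => integrableOn_indicator_Ioi s (Y i)]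
  simp_rw [setIntegral_indicator_Ioi]

/-- Deterministic comparison of the top-`k` sum with `k t + ∫ u in Ioi t, m u`, where `m`
plays the role of the mean of the tail counts. -/
lemma abs_topSum_sub_le {n k : ℕ} (hk : 0 < k) (hkn : k ≤ n) {Y : Fin n → ℝ}
    (hY : ∀ i, 0 ≤ Y i) {t : ℝ} {m : ℝ → ℝ} (hm : IntegrableOn m (Ioi t))
    (hmk : ∀ u ∈ Ioi t, m u ≤ k) :
    |topSum n k Y - (k * t + ∫ u in Ioi t, m u)| ≤
      (∫ u in Ioi t, |tailCount Y u - m u|) + ∫ u in Ioc 0 t, max (k - tailCount Y u) 0 := by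
  have hN := integrableOn_tailCount Y t
  have hB : 0 ≤ ∫ u in Ioc 0 t, max (k - tailCount Y u) 0 :=
    integral_nonneg fun u => le_max_right _ _
  have hA : |∑ i, max (Y i - t) 0 - ∫ u in Ioi t, m u| ≤ ∫ u in Ioi t, |tailCount Y u - m u| := by
    rw [← setIntegral_tailCount, ← integral_sub hN hm]
    exact abs_integral_le_integral_abs
  rw [abs_le]
  constructor
  · obtain ⟨j, hj⟩ := exists_topSum_eq hk hkn Y
    rw [hj]
    set s := Y j with hs
    rcases le_total s t with hst | hst
    · have hsplit : ∫ u in Ioi s, tailCount Y u =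
          (∫ u in Ioc s t, tailCount Y u) + ∫ u in Ioi t, tailCount Y u := by
        rw [← Ioc_union_Ioi_eq_Ioi hst]
        exact setIntegral_union (Set.disjoint_left.2 fun u hu hu' => not_lt.2 hu.2 hu')
          measurableSet_Ioi ((integrableOn_tailCount Y s).mono_set Ioc_subset_Ioi_self) hN
      rw [setIntegral_tailCount, setIntegral_tailCount] at hsplit
      have hNs : IntegrableOn (tailCount Y) (Ioc s t) :=
        (integrableOn_tailCount Y s).mono_set Ioc_subset_Ioi_self
      have hN0 : IntegrableOn (tailCount Y) (Ioc 0 t) :=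
        (integrableOn_tailCount Y 0).mono_set Ioc_subset_Ioi_self
      have hk0 : ∀ a : ℝ, IntegrableOn (fun _ => (k : ℝ)) (Ioc a t) := fun a =>
        integrableOn_const (by simp)
      have hint : IntegrableOn (fun u => max ((k : ℝ) - tailCount Y u) 0) (Ioc 0 t) :=
        ((hk0 0).sub hN0).pos_part
      have h1 : ∫ u in Ioc s t, ((k : ℝ) - tailCount Y u) ≤
          ∫ u in Ioc 0 t, max (k - tailCount Y u) 0 := by
        have hsub : Ioc s t ⊆ Ioc 0 t := Ioc_subset_Ioc_left (hY j)
        calc ∫ u in Ioc s t, ((k : ℝ) - tailCount Y u)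
            ≤ ∫ u in Ioc s t, max (k - tailCount Y u) 0 :=
              integral_mono ((hk0 s).sub hNs) (hint.mono_set hsub) fun u => le_max_left _ _
          _ ≤ _ := setIntegral_mono_set hint (.of_forall fun u => le_max_right _ _)
              hsub.eventuallyLE
      rw [integral_sub (hk0 s) hNs, setIntegral_const, Real.volume_real_Ioc_of_le hst,
        smul_eq_mul] at h1
      have := (abs_le.1 hA).1
      linarith
    · have hks : IntegrableOn ((Iic s).indicator fun _ => (k : ℝ)) (Ioi t) := by
        rw [IntegrableOn, integrable_indicator_iff measurableSet_Iic, IntegrableOn,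
          Measure.restrict_restrict measurableSet_Iic, inter_comm, Ioi_inter_Iic]
        exact integrableOn_const (by simp)
      have hNs : IntegrableOn ((Ioi s).indicator (tailCount Y)) (Ioi t) :=
        hN.indicator measurableSet_Ioi
      have hks' : ∫ u in Ioi t, (Iic s).indicator (fun _ => (k : ℝ)) u = k * (s - t) := by
        rw [integral_indicator measurableSet_Iic, Measure.restrict_restrict measurableSet_Iic,
          inter_comm, Ioi_inter_Iic, setIntegral_const, Real.volume_real_Ioc_of_le hst,
          smul_eq_mul, mul_comm]
      have hNs' : ∫ u in Ioi t, (Ioi s).indicator (tailCount Y) u = ∑ i, max (Y i - s) 0 := by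
        rw [integral_indicator measurableSet_Ioi, Measure.restrict_restrict measurableSet_Ioi,
          inter_eq_left.2 (Ioi_subset_Ioi hst), setIntegral_tailCount]
      have h1 : ∫ u in Ioi t, (m u - ((Iic s).indicator (fun _ => (k : ℝ)) u +
          (Ioi s).indicator (tailCount Y) u)) ≤ ∫ u in Ioi t, |tailCount Y u - m u| := by
        refine setIntegral_mono_on (hm.sub (hks.add hNs)) (hN.sub hm).abs measurableSet_Ioi
          fun u hu => ?_
        by_cases hus : u ≤ s
        · have := hmk u hu
          have := abs_nonneg (tailCount Y u - m u)
          simp only [mem_Iic, hus, indicator_of_mem, mem_Ioi, not_lt,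
            indicator_of_notMem]
          linarith
        · have := neg_abs_le (tailCount Y u - m u)
          simp only [mem_Iic, hus, not_false_eq_true, indicator_of_notMem, mem_Ioi,
            not_le.1 hus, indicator_of_mem]
          linarith
      have h2 : ∫ u in Ioi t, (m u - ((Iic s).indicator (fun _ => (k : ℝ)) u +
          (Ioi s).indicator (tailCount Y) u)) =
          (∫ u in Ioi t, m u) - (k * (s - t) + ∑ i, max (Y i - s) 0) := by
        rw [← hks', ← hNs', ← integral_add hks hNs]
        exact integral_sub hm (hks.add hNs)
      linarith
  · have h1 := topSum_le hkn Y t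
    have h2 := (abs_le.1 hA).2
    linarith

lemma chiSq1_real_Ioi_le_exp {t u : ℝ} (ht : 0 ≤ t) (htu : t ≤ u) :
    chiSq1.real (Ioi u) ≤ Real.exp (-(u - t) / 2) * chiSq1.real (Ioi t) := by
  simpa using chiSq1_real_Ioi_add_le ht (sub_nonneg.2 htu)

lemma antitone_chiSq1_real_Ioi : Antitone fun u => chiSq1.real (Ioi u) := fun _ _ h =>
  measureReal_mono (Ioi_subset_Ioi h)

lemma integrableOn_chiSq1_real_Ioi {t : ℝ} (ht : 0 ≤ t) :
    IntegrableOn (fun u => chiSq1.real (Ioi u)) (Ioi t) := by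
  have h : IntegrableOn (fun u : ℝ => Real.exp (t / 2) * Real.exp (-(1 / 2) * u)) (Ioi t) :=
    (integrableOn_exp_mul_Ioi (by norm_num) t).const_mul _
  refine Integrable.mono' h antitone_chiSq1_real_Ioi.measurable.aestronglyMeasurable ?_
  refine (ae_restrict_iff' measurableSet_Ioi).2 (.of_forall fun u hu => ?_)
  rw [Real.norm_of_nonneg measureReal_nonneg, ← Real.exp_add]
  refine (chiSq1_real_Ioi_le_exp ht (le_of_lt hu)).trans ?_
  refine (mul_le_of_le_one_right (Real.exp_pos _).le measureReal_le_one).trans_eq ?_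
  ring_nf

lemma condExpGt_mul {t : ℝ} (hpos : chiSq1.real (Ioi t) ≠ 0) :
    condExpGt t * chiSq1.real (Ioi t) =
      t * chiSq1.real (Ioi t) + ∫ u in Ioi t, chiSq1.real (Ioi u) := by
  have hint : Integrable (fun y => max (y - t) 0) chiSq1 :=
    (integrable_id_chiSq1.sub (integrable_const t)).pos_part
  have hlayer := hint.integral_eq_integral_meas_lt (.of_forall fun y => le_max_right _ _)
  have hshift := (measurePreserving_add_right volume t).setIntegral_preimage_emb
    (measurableEmbedding_addRight t) (fun u => chiSq1.real (Ioi u)) (Ioi t)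
  have hset : (fun x => x + t) ⁻¹' Ioi t = Ioi 0 := by
    ext x
    simp
  have hlayer' : ∫ y, max (y - t) 0 ∂chiSq1 = ∫ u in Ioi t, chiSq1.real (Ioi u) := by
    rw [hlayer, ← hshift, hset]
    refine setIntegral_congr_fun measurableSet_Ioi fun x hx => ?_
    have hx0 : 0 < x := hx
    congr 1
    ext y
    simp only [mem_ofPred_eq, mem_Ioi, lt_max_iff, not_lt.2 hx0.le, or_false]
    exact lt_sub_iff_add_lt
  have hind : ∫ y, max (y - t) 0 ∂chiSq1 = ∫ y in Ioi t, (y - t) ∂chiSq1 := by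
    rw [← integral_indicator measurableSet_Ioi]
    congr 1
    ext y
    by_cases hy : t < y
    · simp [hy, hy.le]
    · simp [hy, not_lt.1 hy]
  rw [integral_sub integrable_id_chiSq1.integrableOn (integrable_const t), setIntegral_const,
    smul_eq_mul, hlayer'] at hind
  rw [condExpGt, ← measureReal_def, div_mul_cancel₀ _ hpos]
  linarith

lemma le_condExpGt {t : ℝ} (hpos : 0 < chiSq1.real (Ioi t)) : t ≤ condExpGt t := by
  have h := condExpGt_mul hpos.ne'
  have h0 : 0 ≤ ∫ u in Ioi t, chiSq1.real (Ioi u) := integral_nonneg fun _ => measureReal_nonneg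
  exact le_of_mul_le_mul_right (by linarith) hpos

lemma setLIntegral_Ioi_exp {c a : ℝ} (hc : 0 ≤ c) (ha : 0 < a) (t : ℝ) :
    ∫⁻ u in Ioi t, ENNReal.ofReal (c * Real.exp (-(a * (u - t)))) = ENNReal.ofReal (c / a) := by
  have h : ∀ u, c * Real.exp (-(a * (u - t))) = c * Real.exp (a * t) * Real.exp (-a * u) := by
    intro u
    rw [mul_assoc, ← Real.exp_add]
    ring_nf
  simp_rw [h]
  rw [← ofReal_integral_eq_lintegral_ofReal
    ((integrableOn_exp_mul_Ioi (neg_lt_zero.2 ha) t).const_mul _)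
    (.of_forall fun u => by positivity), integral_const_mul,
    integral_exp_mul_Ioi (neg_lt_zero.2 ha), neg_div_neg_eq, mul_div_assoc', mul_assoc,
    ← Real.exp_add]
  simp

lemma setLIntegral_Iic_exp {c a : ℝ} (hc : 0 ≤ c) (ha : 0 < a) (t : ℝ) :
    ∫⁻ u in Iic t, ENNReal.ofReal (c * Real.exp (-(a * (t - u)))) = ENNReal.ofReal (c / a) := by
  have h : ∀ u, c * Real.exp (-(a * (t - u))) = c * Real.exp (-(a * t)) * Real.exp (a * u) := by
    intro u
    rw [mul_assoc, ← Real.exp_add]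
    ring_nf
  simp_rw [h]
  rw [← ofReal_integral_eq_lintegral_ofReal ((integrableOn_exp_mul_Iic ha t).const_mul _)
    (.of_forall fun u => by positivity), integral_const_mul,
    integral_exp_mul_Iic ha, mul_div_assoc', mul_assoc, ← Real.exp_add]
  simp

lemma lintegral_tailCount_above_le {n k : ℕ} {t : ℝ} (ht : 0 ≤ t)
    (h : n * chiSq1.real (Ioi t) = k) :
    ∫⁻ Y : Fin n → ℝ, (∫⁻ u in Ioi t, ENNReal.ofReal |tailCount Y u - n * chiSq1.real (Ioi u)|)
        ∂(Measure.pi fun _ => chiSq1) ≤ ENNReal.ofReal (4 * √k) := by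
  have hmeas : Measurable fun p : (Fin n → ℝ) × ℝ =>
      ENNReal.ofReal |tailCount p.1 p.2 - n * chiSq1.real (Ioi p.2)| := by
    have h1 := measurable_uncurry_tailCount (n := n)
    have h2 := antitone_chiSq1_real_Ioi.measurable.comp
      (measurable_snd : Measurable fun p : (Fin n → ℝ) × ℝ => p.2)
    exact (measurable_norm.comp (h1.sub (h2.const_mul _))).ennreal_ofReal
  rw [lintegral_lintegral_swap hmeas.aemeasurable]
  calc _ ≤ ∫⁻ u in Ioi t, ENNReal.ofReal (√k * Real.exp (-(1 / 4 * (u - t)))) := by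
        refine setLIntegral_mono (by fun_prop) fun u hu => ?_
        refine (lintegral_abs_tailCount_sub_le u).trans (ENNReal.ofReal_le_ofReal ?_)
        refine Real.sqrt_le_iff.2 ⟨by positivity, ?_⟩
        rw [mul_pow, Real.sq_sqrt (by positivity), ← h, ← Real.exp_nat_mul, mul_assoc]
        refine mul_le_mul_of_nonneg_left ?_ (by positivity)
        refine (chiSq1_real_Ioi_le_exp ht (le_of_lt hu)).trans_eq ?_
        rw [mul_comm]
        push_cast
        ring_nf
    _ = ENNReal.ofReal (4 * √k) := by
        rw [setLIntegral_Ioi_exp (by positivity) (by norm_num)]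
        ring_nf

lemma lintegral_tailCount_below_le {n k : ℕ} (hk : 0 < k) {t : ℝ}
    (h : n * chiSq1.real (Ioi t) = k) :
    ∫⁻ Y : Fin n → ℝ, (∫⁻ u in Ioc 0 t, ENNReal.ofReal (k - tailCount Y u))
        ∂(Measure.pi fun _ => chiSq1) ≤ ENNReal.ofReal (16 * √k) := by
  have hmeas : Measurable fun p : (Fin n → ℝ) × ℝ =>
      ENNReal.ofReal (k - tailCount p.1 p.2) :=
    (measurable_uncurry_tailCount.const_sub _).ennreal_ofReal
  rw [lintegral_lintegral_swap hmeas.aemeasurable]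
  calc _ ≤ ∫⁻ u in Ioc 0 t, ENNReal.ofReal (8 * √k * Real.exp (-(1 / 2 * (t - u)))) := by
        refine setLIntegral_mono (by fun_prop) fun u hu => ?_
        have hr : 1 ≤ Real.exp ((t - u) / 2) :=
          Real.one_le_exp (by linarith [hu.2])
        have hle : k * Real.exp ((t - u) / 2) ≤ n * chiSq1.real (Ioi u) := by
          have h1 := chiSq1_real_Ioi_le_exp hu.1.le hu.2
          rw [neg_div, Real.exp_neg, inv_mul_eq_div, le_div_iff₀ (Real.exp_pos _)] at h1
          rw [← h, mul_assoc]
          gcongr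
        refine (lintegral_sub_tailCount_le hk u hr hle).trans (ENNReal.ofReal_le_ofReal ?_)
        set r := Real.exp ((t - u) / 2) with hrdef
        have hr2 : Real.exp (-(1 / 2 * (t - u))) = r⁻¹ := by
          rw [hrdef, ← Real.exp_neg]
          ring_nf
        have h2 : Real.exp (-(r / 4)) ≤ 4 * r⁻¹ := by
          rw [Real.exp_neg, inv_le_comm₀ (Real.exp_pos _) (by positivity), mul_inv, inv_inv]
          linarith [Real.add_one_le_exp (r / 4)]
        rw [hr2]
        have : 0 ≤ √(k : ℝ) := Real.sqrt_nonneg _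
        nlinarith
    _ ≤ ∫⁻ u in Iic t, ENNReal.ofReal (8 * √k * Real.exp (-(1 / 2 * (t - u)))) :=
        lintegral_mono_set Ioc_subset_Iic_self
    _ = ENNReal.ofReal (16 * √k) := by
        rw [setLIntegral_Iic_exp (by positivity) (by norm_num)]
        ring_nf

lemma lintegral_abs_topSum_sub_le {n k : ℕ} (hk : 0 < k) (hkn : k ≤ n) {t : ℝ} (ht : 0 ≤ t)
    (h : n * chiSq1.real (Ioi t) = k) :
    ∫⁻ Y, ENNReal.ofReal |topSum n k Y - k * condExpGt t| ∂(Measure.pi fun _ => chiSq1) ≤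
      ENNReal.ofReal (20 * √k) := by
  have hpos : chiSq1.real (Ioi t) ≠ 0 := by
    rintro h0
    rw [h0, mul_zero] at h
    exact hk.ne (by exact_mod_cast h)
  have hcond : k * condExpGt t = k * t + ∫ u in Ioi t, n * chiSq1.real (Ioi u) := by
    rw [integral_const_mul, ← h]
    linear_combination (n : ℝ) * condExpGt_mul hpos
  have hG : IntegrableOn (fun u => n * chiSq1.real (Ioi u)) (Ioi t) :=
    (integrableOn_chiSq1_real_Ioi ht).const_mul _
  have hGk : ∀ u ∈ Ioi t, n * chiSq1.real (Ioi u) ≤ k := by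
    intro u hu
    rw [← h]
    exact mul_le_mul_of_nonneg_left (antitone_chiSq1_real_Ioi (le_of_lt hu)) n.cast_nonneg
  have hnonneg : ∀ᵐ Y : Fin n → ℝ ∂(Measure.pi fun _ => chiSq1), ∀ i, 0 ≤ Y i :=
    ae_all_iff.2 fun i =>
      (measurePreserving_eval (fun _ : Fin n => chiSq1) i).quasiMeasurePreserving.ae
        ae_nonneg_chiSq1
  have hpt : ∀ᵐ Y : Fin n → ℝ ∂(Measure.pi fun _ => chiSq1),
      ENNReal.ofReal |topSum n k Y - k * condExpGt t| ≤
        (∫⁻ u in Ioi t, ENNReal.ofReal |tailCount Y u - n * chiSq1.real (Ioi u)|) +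
          ∫⁻ u in Ioc 0 t, ENNReal.ofReal (k - tailCount Y u) := by
    filter_upwards [hnonneg] with Y hY
    rw [hcond]
    refine (ENNReal.ofReal_le_ofReal (abs_topSum_sub_le hk hkn hY hG hGk)).trans ?_
    have h1 : IntegrableOn (fun u => |tailCount Y u - n * chiSq1.real (Ioi u)|) (Ioi t) :=
      ((integrableOn_tailCount Y t).sub hG).abs
    have h2 : IntegrableOn (fun u => max ((k : ℝ) - tailCount Y u) 0) (Ioc 0 t) :=
      ((integrableOn_const (by simp)).sub
        ((integrableOn_tailCount Y 0).mono_set Ioc_subset_Ioi_self)).pos_part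
    refine ENNReal.ofReal_add_le.trans (add_le_add ?_ ?_)
    · rw [ofReal_integral_eq_lintegral_ofReal h1 (.of_forall fun u => abs_nonneg _)]
    · rw [ofReal_integral_eq_lintegral_ofReal h2 (.of_forall fun u => le_max_right _ _)]
      simp
  have hmeas : Measurable fun Y : Fin n → ℝ =>
      ∫⁻ u in Ioc 0 t, ENNReal.ofReal (k - tailCount Y u) :=
    Measurable.lintegral_prod_right' (f := fun p : (Fin n → ℝ) × ℝ =>
      ENNReal.ofReal (k - tailCount p.1 p.2))
      (measurable_uncurry_tailCount.const_sub _).ennreal_ofReal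
  refine (lintegral_mono_ae hpt).trans ?_
  rw [lintegral_add_right _ hmeas]
  refine (add_le_add (lintegral_tailCount_above_le ht h)
    (lintegral_tailCount_below_le hk h)).trans_eq ?_
  rw [← ENNReal.ofReal_add (by positivity) (by positivity)]
  ring_nf

lemma abs_sqrt_sub_sqrt_le (z : ℝ) {m : ℝ} (hm : 0 < m) : |√z - √m| ≤ |z - m| / √m := by
  have hm' : 0 < √m := Real.sqrt_pos.2 hm
  rw [le_div_iff₀ hm']
  rcases le_total 0 z with hz | hz
  · calc |√z - √m| * √m ≤ |√z - √m| * (√z + √m) := by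
          gcongr
          linarith [Real.sqrt_nonneg z]
      _ = |z - m| := by
          rw [← abs_of_nonneg (by positivity : 0 ≤ √z + √m), ← abs_mul]
          congr 1
          linear_combination Real.sq_sqrt hz - Real.sq_sqrt hm.le
  · rw [Real.sqrt_eq_zero_of_nonpos hz, zero_sub, abs_neg, abs_of_nonneg hm'.le,
      Real.mul_self_sqrt hm.le, abs_sub_comm]
    exact (by linarith : m ≤ m - z).trans (le_abs_self _)

lemma abs_integral_sqrt_sub_sqrt_le {α : Type*} [MeasurableSpace α] {P : Measure α}
    [IsProbabilityMeasure P] {Z : α → ℝ} (hZ : Measurable Z) {m b : ℝ} (hm : 0 < m) (hb : 0 ≤ b)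
    (h : ∫⁻ a, ENNReal.ofReal |Z a - m| ∂P ≤ ENNReal.ofReal b) :
    |(∫ a, √(Z a) ∂P) - √m| ≤ b / √m := by
  have hint : Integrable (fun a => |Z a - m|) P := by
    refine ⟨(hZ.sub_const m).norm.aestronglyMeasurable, ?_⟩
    rw [hasFiniteIntegral_iff_ofReal (.of_forall fun a => abs_nonneg _)]
    exact h.trans_lt ENNReal.ofReal_lt_top
  have hle : ∫ a, |Z a - m| ∂P ≤ b := by
    rw [← ofReal_integral_eq_lintegral_ofReal hint (.of_forall fun a => abs_nonneg _)] at h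
    exact (ENNReal.ofReal_le_ofReal_iff hb).1 h
  have hdiff : Integrable (fun a => √(Z a) - √m) P :=
    (hint.div_const (√m)).mono' (hZ.sqrt.sub_const _).aestronglyMeasurable
      (.of_forall fun a => abs_sqrt_sub_sqrt_le (Z a) hm)
  have hsqrt : Integrable (fun a => √(Z a)) P := by
    refine (hdiff.add (integrable_const (√m))).congr (.of_forall fun a => ?_)
    simp
  calc |(∫ a, √(Z a) ∂P) - √m| = |∫ a, (√(Z a) - √m) ∂P| := by
        rw [integral_sub hsqrt (integrable_const _)]
        simp
    _ ≤ ∫ a, |√(Z a) - √m| ∂P := abs_integral_le_integral_abs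
    _ ≤ ∫ a, |Z a - m| / √m ∂P :=
        integral_mono hdiff.abs (hint.div_const _) fun a => abs_sqrt_sub_sqrt_le (Z a) hm
    _ ≤ b / √m := by
        rw [integral_div]
        gcongr

/-- **Expectation bound for the top-`k` sum of i.i.d. χ²₁ order statistics.**
With `T_k = √((1/k) Σ_{i≤k} Y_(i))`, `t` defined by `P(Y₁ > t) = k/n` and
`T = √(E(Y₁ | Y₁ > t))`, there is a universal `C > 0` with
`|E T_k − T| ≤ C/√(k log(n/k))` whenever `k/n < 1/5`. -/
theorem abs_expectation_topSum_sub_le :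
    ∃ C : ℝ, 0 < C ∧
      ∀ (n k : ℕ) (t T : ℝ), 0 < k → (k : ℝ) / n < 1 / 5 →
        chiSq1 (Set.Ioi t) = ENNReal.ofReal ((k : ℝ) / n) →
        T = Real.sqrt (condExpGt t) →
        |(∫ Y, Real.sqrt (topSum n k Y / k) ∂(Measure.pi fun _ : Fin n => chiSq1)) - T| ≤
          C / Real.sqrt (k * Real.log ((n : ℝ) / k)) := by
  refine ⟨60, by norm_num, ?_⟩
  rintro n k t T hk hkn htail rfl
  have hk0 : (0 : ℝ) < k := by exact_mod_cast hk
  have hG : chiSq1.real (Ioi t) = k / n := by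
    rw [measureReal_def, htail, ENNReal.toReal_ofReal (by positivity)]
  have ht : 1 / 4 ≤ t := by
    by_contra! hlt
    have h1 : chiSq1.real (Ioi (1 / 4)) ≤ chiSq1.real (Ioi t) := antitone_chiSq1_real_Ioi hlt.le
    have h2 := half_le_chiSq1_real_Ioi
    linarith
  have ht0 : 0 ≤ t := by linarith
  have hlow := exp_neg_le_chiSq1_real_Ioi ht0
  have hpos : 0 < chiSq1.real (Ioi t) := (Real.exp_pos _).trans_le hlow
  have hn : (0 : ℝ) < n := by
    refine (Nat.cast_nonneg n).lt_of_ne fun h0 => ?_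
    rw [hG, ← h0, div_zero] at hpos
    exact lt_irrefl _ hpos
  have hkn' : k ≤ n := by
    rw [div_lt_iff₀ hn] at hkn
    exact_mod_cast (by linarith : (k : ℝ) ≤ n)
  have hnG : n * chiSq1.real (Ioi t) = k := by
    rw [hG]
    field_simp
  have hm := le_condExpGt hpos
  set m := condExpGt t
  have hm0 : 0 < m := by linarith
  have hZ : Measurable fun Y => topSum n k Y / k := (measurable_topSum hkn').div_const _
  have hL : ∫⁻ Y, ENNReal.ofReal |topSum n k Y / k - m| ∂(Measure.pi fun _ : Fin n => chiSq1) ≤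
      ENNReal.ofReal (20 / √k) := by
    have heq : ∀ Y : Fin n → ℝ, ENNReal.ofReal |topSum n k Y / k - m| =
        ENNReal.ofReal (1 / k) * ENNReal.ofReal |topSum n k Y - k * m| := by
      intro Y
      rw [← ENNReal.ofReal_mul (by positivity)]
      nth_rewrite 1 [← abs_of_pos (by positivity : 0 < 1 / (k : ℝ))]
      rw [← abs_mul]
      congr 2
      field_simp
    simp_rw [heq]
    rw [lintegral_const_mul' _ _ ENNReal.ofReal_ne_top]
    refine (mul_le_mul_right (lintegral_abs_topSum_sub_le hk hkn' ht0 hnG) _).trans_eq ?_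
    rw [← ENNReal.ofReal_mul (by positivity)]
    congr 1
    have hs : 0 < √(k : ℝ) := Real.sqrt_pos.2 hk0
    rw [div_mul_eq_mul_div, one_mul, div_eq_div_iff hk0.ne' hs.ne', mul_assoc,
      Real.mul_self_sqrt hk0.le]
  refine (abs_integral_sqrt_sub_sqrt_le hZ hm0 (by positivity) hL).trans ?_
  have hlog : Real.log (n / k) ≤ 9 * m := by
    rw [← inv_div, ← hG, Real.log_inv]
    have := (Real.le_log_iff_exp_le hpos).2 hlow
    linarith
  have hlog0 : 0 < Real.log (n / k) := by
    refine Real.log_pos ((one_lt_div hk0).2 ?_)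
    rw [div_lt_iff₀ hn] at hkn
    linarith
  have hsqrt : √(k * Real.log (n / k)) ≤ 3 * (√k * √m) := by
    rw [← Real.sqrt_mul hk0.le]
    refine Real.sqrt_le_iff.2 ⟨by positivity, ?_⟩
    rw [mul_pow, Real.sq_sqrt (by positivity)]
    nlinarith
  rw [div_div, div_le_div_iff₀ (by positivity) (by positivity)]
  linarith
end

section
/- There exists a constant C > 0 such that for any n×N random matrix A with i.i.d. standard Gaussian entries and any sparsity level s with s/N < 1/5, E(σ_max^s(A)) ≤ √n + √s·T + C/√(log(N/s)), where T = √(E(Y | Y > t)) with Y a χ²₁ random variable and t defined by P(Y > t) = s/N. -/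
open MeasureTheory ProbabilityTheory

/-- Law of an `n × N` matrix with i.i.d. standard Gaussian entries. -/
noncomputable def gaussianMatrixMeasure (n N : ℕ) : Measure (Fin n → Fin N → ℝ) :=
  Measure.pi fun _ => Measure.pi fun _ => gaussianReal 0 1

/-- The set Ψ_s of `s`-sparse unit vectors in `ℝ^N`. -/
def sparseUnitVecs (N s : ℕ) : Set (Fin N → ℝ) :=
  {x | (∑ j, x j ^ 2) = 1 ∧ (Finset.univ.filter fun j => x j ≠ 0).card ≤ s}

/-- `‖A x‖²` for `A : ℝ^{n×N}`, `x : ℝ^N`. -/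
noncomputable def normSqMulVec {n N : ℕ} (A : Fin n → Fin N → ℝ) (x : Fin N → ℝ) : ℝ :=
  ∑ i, (∑ j, A i j * x j) ^ 2

/-- `σ_max^s(A) = sup_{x ∈ Ψ_s} ‖Ax‖`. -/
noncomputable def sigmaMax (n N s : ℕ) (A : Fin n → Fin N → ℝ) : ℝ :=
  sSup ((fun x => Real.sqrt (normSqMulVec A x)) '' sparseUnitVecs N s)

/-- **Gaussian integration by parts** on the real line. -/
lemma integral_id_mul_gaussianReal {f f' : ℝ → ℝ} {C : ℝ} (hf : ∀ x, HasDerivAt f (f' x) x)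
    (hb : ∀ x, |f x| ≤ C) (hb' : ∀ x, |f' x| ≤ C) :
    ∫ x, x * f x ∂gaussianReal 0 1 = ∫ x, f' x ∂gaussianReal 0 1 := by
  have hv : (1 : NNReal) ≠ 0 := one_ne_zero
  have hf'm : Measurable f' := by
    have : f' = deriv f := funext fun x => (hf x).deriv.symm
    rw [this]; exact measurable_deriv f
  have hfc : Continuous f := continuous_iff_continuousAt.2 fun x => (hf x).continuousAt
  have hpdf : ∀ x, HasDerivAt (gaussianPDFReal 0 1) (-x * gaussianPDFReal 0 1 x) x := by
    intro x
    have h1 : gaussianPDFReal 0 1 = fun y : ℝ =>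
        (Real.sqrt (2 * Real.pi * 1))⁻¹ * Real.exp (-(y - 0) ^ 2 / (2 * 1)) := by
      rw [gaussianPDFReal_def]; simp
    rw [h1]
    have h2 : HasDerivAt (fun y : ℝ => -(y - 0) ^ 2 / (2 * 1)) (-x) x := by
      have := ((((hasDerivAt_id x).sub_const 0).pow 2).neg).div_const (2 * 1)
      refine (this.congr_deriv ?_)
      simp; ring
    refine ((h2.exp).const_mul _).congr_deriv ?_
    ring
  have hi := integrable_gaussianPDFReal 0 1
  have hxi : Integrable (fun x => x * gaussianPDFReal 0 1 x) := by
    have h := (memLp_id_gaussianReal (μ := 0) (v := 1) 1).integrable (by simp)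
    rw [gaussianReal_of_var_ne_zero _ hv, integrable_withDensity_iff_integrable_smul'
      (measurable_gaussianPDF 0 1) (by simp [gaussianPDF_lt_top])] at h
    refine h.congr (Filter.Eventually.of_forall fun x => ?_)
    simp [toReal_gaussianPDF, mul_comm]
  have i1 : Integrable (fun x => f' x * gaussianPDFReal 0 1 x) :=
    hi.bdd_mul hf'm.aestronglyMeasurable (Filter.Eventually.of_forall hb')
  have i2 : Integrable (fun x => f x * (-x * gaussianPDFReal 0 1 x)) := by
    refine Integrable.bdd_mul (c := C) ?_ hfc.aestronglyMeasurable (Filter.Eventually.of_forall hb)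
    simpa using hxi.neg
  have i3 : Integrable (fun x => f x * gaussianPDFReal 0 1 x) :=
    hi.bdd_mul hfc.aestronglyMeasurable (Filter.Eventually.of_forall hb)
  have key := integral_eq_zero_of_hasDerivAt_of_integrable
    (fun x => (hf x).mul (hpdf x)) (i1.add i2) i3
  rw [integral_gaussianReal_eq_integral_smul hv, integral_gaussianReal_eq_integral_smul hv]
  rw [integral_add i1 i2] at key
  have e : ∀ x, f x * (-x * gaussianPDFReal 0 1 x) = -(gaussianPDFReal 0 1 x • (x * f x)) := by
    intro x; simp only [smul_eq_mul]; ring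
  simp_rw [e, integral_neg] at key
  have e2 : ∀ x, gaussianPDFReal 0 1 x • f' x = f' x * gaussianPDFReal 0 1 x := by
    intro x; simp only [smul_eq_mul]; ring
  simp_rw [e2]
  linarith

/-- Resampling one coordinate preserves a product probability measure. -/
lemma measurePreserving_update_pi {ι : Type*} [Fintype ι] [DecidableEq ι] {X : ι → Type*}
    [∀ i, MeasurableSpace (X i)] (μ : ∀ i, Measure (X i)) [∀ i, IsProbabilityMeasure (μ i)]
    (k : ι) :
    MeasurePreserving (fun p : (∀ i, X i) × X k => Function.update p.1 k p.2)
      ((Measure.pi μ).prod (μ k)) (Measure.pi μ) := by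
  have hm : Measurable (fun p : (∀ i, X i) × X k => Function.update p.1 k p.2) := by
    refine measurable_pi_iff.2 fun i => ?_
    by_cases h : i = k
    · subst h; simpa using measurable_snd
    · simp only [Function.update_of_ne h]
      exact (measurable_pi_apply i).comp measurable_fst
  refine ⟨hm, ?_⟩
  symm
  refine Measure.pi_eq fun s hs => ?_
  rw [Measure.map_apply hm (MeasurableSet.univ_pi hs)]
  have : (fun p : (∀ i, X i) × X k => Function.update p.1 k p.2) ⁻¹' (Set.univ.pi s) =
      (Set.univ.pi (Function.update s k Set.univ)) ×ˢ (s k) := by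
    ext p
    simp only [Set.mem_preimage, Set.mem_pi, Set.mem_univ, true_implies, Set.mem_prod]
    constructor
    · intro h
      refine ⟨fun i => ?_, by simpa using h k⟩
      by_cases hi : i = k
      · subst hi; simp
      · simpa [Function.update_of_ne hi] using h i
    · rintro ⟨h1, h2⟩ i
      by_cases hi : i = k
      · subst hi; simpa using h2
      · simpa [Function.update_of_ne hi] using h1 i
  rw [this, Measure.prod_prod, Measure.pi_pi, ← Finset.mul_prod_erase _ _ (Finset.mem_univ k),
    ← Finset.mul_prod_erase _ (fun i => μ i (s i)) (Finset.mem_univ k)]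
  simp only [Function.update_self, measure_univ, one_mul]
  rw [mul_comm]
  congr 1
  exact Finset.prod_congr rfl fun i hi => by rw [Function.update_of_ne (Finset.ne_of_mem_erase hi)]

/-- The standard Gaussian measure on `ι → ℝ`. -/
noncomputable abbrev gaussianPi (ι : Type*) [Fintype ι] : Measure (ι → ℝ) :=
  Measure.pi fun _ => gaussianReal 0 1

lemma integrable_eval_gaussianPi {ι : Type*} [Fintype ι] (k : ι) :
    Integrable (fun x : ι → ℝ => x k) (gaussianPi ι) := by
  have h := (memLp_id_gaussianReal (μ := 0) (v := 1) 1).integrable (by simp)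
  exact (measurePreserving_eval (fun _ : ι => gaussianReal 0 1) k).integrable_comp_of_integrable h

/-- **Gaussian integration by parts** in one coordinate of a standard Gaussian vector. -/
lemma integral_eval_mul_gaussianPi {ι : Type*} [Fintype ι] [DecidableEq ι] (k : ι)
    {f f' : (ι → ℝ) → ℝ} {C : ℝ} (hfm : Measurable f) (hfm' : Measurable f')
    (hf : ∀ x t, HasDerivAt (fun u => f (Function.update x k u)) (f' (Function.update x k t)) t)
    (hb : ∀ x, |f x| ≤ C) (hb' : ∀ x, |f' x| ≤ C) :
    ∫ x, x k * f x ∂gaussianPi ι = ∫ x, f' x ∂gaussianPi ι := by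
  have mp := measurePreserving_update_pi (fun _ : ι => gaussianReal 0 1) k
  have i1 : Integrable (fun x => x k * f x) (gaussianPi ι) :=
    (integrable_eval_gaussianPi k).mul_bdd (c := C) hfm.aestronglyMeasurable
      (Filter.Eventually.of_forall hb)
  have i2 : Integrable f' (gaussianPi ι) :=
    Integrable.of_bound hfm'.aestronglyMeasurable C (Filter.Eventually.of_forall hb')
  have t1 : ∀ g : (ι → ℝ) → ℝ, Integrable g (gaussianPi ι) →
      ∫ x, g x ∂gaussianPi ι =
        ∫ x, ∫ t, g (Function.update x k t) ∂gaussianReal 0 1 ∂gaussianPi ι := by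
    intro g hg
    rw [← integral_prod (fun p : (ι → ℝ) × ℝ => g (Function.update p.1 k p.2))
      (mp.integrable_comp_of_integrable hg), ← integral_map mp.measurable.aemeasurable, mp.map_eq]
    rw [mp.map_eq]; exact hg.aestronglyMeasurable
  rw [t1 _ i1, t1 _ i2]
  congr 1; ext x
  simp only [Function.update_self]
  exact integral_id_mul_gaussianReal (fun t => hf x t) (fun t => hb _) (fun t => hb' _)

section LogSumExp

variable {I : Type*} [Fintype I]

/-- The log-sum-exp function. -/
noncomputable def logSumExp (z : I → ℝ) : ℝ := Real.log (∑ i, Real.exp (z i))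

/-- The softmax weights, i.e. the gradient of `logSumExp`. -/
noncomputable def softmax (z : I → ℝ) (i : I) : ℝ := Real.exp (z i) / ∑ j, Real.exp (z j)

lemma softmax_nonneg (z : I → ℝ) (i : I) : 0 ≤ softmax z i := by
  unfold softmax; positivity

variable [Nonempty I]

lemma sum_exp_pos (z : I → ℝ) : 0 < ∑ i, Real.exp (z i) :=
  Finset.sum_pos (fun _ _ => Real.exp_pos _) Finset.univ_nonempty

lemma sum_softmax (z : I → ℝ) : ∑ i, softmax z i = 1 := by
  unfold softmax
  rw [← Finset.sum_div, div_self (sum_exp_pos z).ne']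

lemma softmax_le_one (z : I → ℝ) (i : I) : softmax z i ≤ 1 := by
  rw [← sum_softmax z]
  exact Finset.single_le_sum (fun j _ => softmax_nonneg z j) (Finset.mem_univ i)

lemma le_logSumExp (z : I → ℝ) (i : I) : z i ≤ logSumExp z := by
  rw [logSumExp, Real.le_log_iff_exp_le (sum_exp_pos z)]
  exact Finset.single_le_sum (f := fun i => Real.exp (z i)) (fun j _ => (Real.exp_pos _).le)
    (Finset.mem_univ i)

lemma logSumExp_le {z : I → ℝ} {M : ℝ} (h : ∀ i, z i ≤ M) :
    logSumExp z ≤ M + Real.log (Fintype.card I) := by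
  have hc : (0 : ℝ) < Fintype.card I := by exact_mod_cast Fintype.card_pos
  rw [logSumExp, Real.log_le_iff_le_exp (sum_exp_pos z), Real.exp_add, Real.exp_log hc, mul_comm,
    ← nsmul_eq_mul]
  exact Finset.sum_le_card_nsmul _ _ _ fun i _ => Real.exp_le_exp.2 (h i)

lemma abs_logSumExp_le (z : I → ℝ) :
    |logSumExp z| ≤ ∑ i, |z i| + Real.log (Fintype.card I) := by
  have h1 : ∀ i, |z i| ≤ ∑ i, |z i| := fun i =>
    Finset.single_le_sum (f := fun i => |z i|) (fun j _ => abs_nonneg _) (Finset.mem_univ i)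
  have hc : 0 ≤ Real.log (Fintype.card I) := Real.log_natCast_nonneg _
  rw [abs_le]
  constructor
  · obtain ⟨i⟩ := ‹Nonempty I›
    have := le_logSumExp z i
    have := h1 i
    have := neg_abs_le (z i)
    linarith
  · exact logSumExp_le fun i => (le_abs_self _).trans (h1 i)

lemma hasDerivAt_logSumExp {z : ℝ → I → ℝ} {z' : I → ℝ} {t : ℝ}
    (h : ∀ i, HasDerivAt (fun u => z u i) (z' i) t) :
    HasDerivAt (fun u => logSumExp (z u)) (∑ i, softmax (z t) i * z' i) t := by
  have h1 : HasDerivAt (fun u => ∑ i, Real.exp (z u i)) (∑ i, Real.exp (z t i) * z' i) t :=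
    HasDerivAt.fun_sum fun i _ => (h i).exp
  refine (h1.log (sum_exp_pos (z t)).ne').congr_deriv ?_
  rw [Finset.sum_div]
  exact Finset.sum_congr rfl fun i _ => by unfold softmax; ring

lemma hasDerivAt_softmax {z : ℝ → I → ℝ} {z' : I → ℝ} {t : ℝ}
    (h : ∀ i, HasDerivAt (fun u => z u i) (z' i) t) (i : I) :
    HasDerivAt (fun u => softmax (z u) i)
      (softmax (z t) i * (z' i - ∑ j, softmax (z t) j * z' j)) t := by
  have h1 : HasDerivAt (fun u => ∑ i, Real.exp (z u i)) (∑ i, Real.exp (z t i) * z' i) t :=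
    HasDerivAt.fun_sum fun i _ => (h i).exp
  have hp := (sum_exp_pos (z t)).ne'
  refine ((h i).exp.div h1 hp).congr_deriv ?_
  have : ∑ j, softmax (z t) j * z' j =
      (∑ i, Real.exp (z t i) * z' i) / ∑ i, Real.exp (z t i) := by
    rw [Finset.sum_div]
    exact Finset.sum_congr rfl fun i _ => by unfold softmax; ring
  rw [this]
  unfold softmax
  field_simp

omit [Nonempty I] in
lemma measurable_softmax (i : I) : Measurable (fun z : I → ℝ => softmax z i) := by
  unfold softmax; fun_prop

omit [Nonempty I] in
lemma measurable_logSumExp : Measurable (logSumExp : (I → ℝ) → ℝ) := by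
  unfold logSumExp; fun_prop

end LogSumExp

section SudakovFernique

lemma sum_sub_sq {γ : Type*} [Fintype γ] (w w' : γ → ℝ) :
    ∑ k, (w k - w' k) ^ 2 = ∑ k, w k ^ 2 + ∑ k, w' k ^ 2 - 2 * ∑ k, w k * w' k := by
  rw [Finset.mul_sum, ← Finset.sum_add_distrib, ← Finset.sum_sub_distrib]
  exact Finset.sum_congr rfl fun k _ => by ring

variable {I ι : Type*} [Fintype I] [Fintype ι]

/-- The linear process `x ↦ (∑ k, c i k * x k)_i` with coefficients `c`. -/
def linProc (c : I → ι → ℝ) (x : ι → ℝ) (i : I) : ℝ := ∑ k, c i k * x k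

omit [Fintype I] in
lemma measurable_linProc (c : I → ι → ℝ) : Measurable (linProc c) := by
  unfold linProc; fun_prop

omit [Fintype I] in
lemma integrable_linProc (c : I → ι → ℝ) (i : I) :
    Integrable (fun x => linProc c x i) (gaussianPi ι) :=
  integrable_finsetSum _ fun k _ => (integrable_eval_gaussianPi k).const_mul _

lemma integrable_logSumExp_linProc [Nonempty I] (c : I → ι → ℝ) :
    Integrable (fun x => logSumExp (linProc c x)) (gaussianPi ι) := by
  refine Integrable.mono' (g := fun x => ∑ i, |linProc c x i| + Real.log (Fintype.card I)) ?_
    (measurable_logSumExp.comp (measurable_linProc c)).aestronglyMeasurable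
    (Filter.Eventually.of_forall fun x => abs_logSumExp_le _)
  exact (integrable_finsetSum _ fun i _ => (integrable_linProc c i).abs).add (integrable_const _)

omit [Fintype I] in
lemma hasDerivAt_linProc_update [DecidableEq ι] (c : I → ι → ℝ) (x : ι → ℝ) (k : ι) (i : I)
    (t : ℝ) : HasDerivAt (fun u => linProc c (Function.update x k u) i) (c i k) t := by
  have : (fun u => linProc c (Function.update x k u) i) =
      fun u => c i k * u + ∑ l ∈ Finset.univ.erase k, c i l * x l := by
    ext u
    unfold linProc
    rw [← Finset.add_sum_erase _ _ (Finset.mem_univ k), Function.update_self]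
    congr 1
    exact Finset.sum_congr rfl fun l hl => by
      rw [Function.update_of_ne (Finset.ne_of_mem_erase hl)]
  rw [this]
  exact (((hasDerivAt_id' t).const_mul (c i k)).add_const _).congr_deriv (mul_one _)

lemma integral_eval_mul_softmax [Nonempty I] (c : I → ι → ℝ) (k : ι) (i : I) :
    ∫ x, x k * softmax (linProc c x) i ∂gaussianPi ι =
      ∫ x, softmax (linProc c x) i * (c i k - ∑ j, softmax (linProc c x) j * c j k)
        ∂gaussianPi ι := by
  classical
  have hs : ∀ x i, |softmax (linProc c x) i| ≤ 1 := fun x i => by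
    rw [abs_of_nonneg (softmax_nonneg _ _)]; exact softmax_le_one _ _
  have hm : ∀ i, Measurable fun x => softmax (linProc c x) i := fun i =>
    (measurable_softmax i).comp (measurable_linProc c)
  refine integral_eval_mul_gaussianPi (C := 1 + (|c i k| + ∑ j, |c j k|)) k (hm i) ?_ ?_ ?_ ?_
  · exact (hm i).mul (measurable_const.sub
      (Finset.measurable_fun_sum _ fun j _ => (hm j).mul_const _))
  · intro x t
    exact hasDerivAt_softmax (fun j => hasDerivAt_linProc_update c x k j t) i
  · intro x
    have : 0 ≤ |c i k| + ∑ j, |c j k| := by positivity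
    linarith [hs x i]
  · intro x
    rw [abs_mul]
    have h1 : |c i k - ∑ j, softmax (linProc c x) j * c j k| ≤ |c i k| + ∑ j, |c j k| := by
      refine (abs_sub _ _).trans ?_
      gcongr
      refine (Finset.abs_sum_le_sum_abs _ _).trans (Finset.sum_le_sum fun j _ => ?_)
      rw [abs_mul]
      exact mul_le_of_le_one_left (abs_nonneg _) (hs x j)
    have := mul_le_of_le_one_left (abs_nonneg (c i k - ∑ j, softmax (linProc c x) j * c j k))
      (hs x i)
    linarith

lemma integral_sum_softmax_mul_linProc [Nonempty I] (c c' : I → ι → ℝ) :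
    ∫ x, ∑ i, softmax (linProc c x) i * linProc c' x i ∂gaussianPi ι =
      ∫ x, ∑ i, softmax (linProc c x) i *
        ((∑ k, c' i k * c i k) - ∑ j, softmax (linProc c x) j * ∑ k, c' i k * c j k)
        ∂gaussianPi ι := by
  have hs : ∀ x i, ‖softmax (linProc c x) i‖ ≤ 1 := fun x i => by
    rw [Real.norm_of_nonneg (softmax_nonneg _ _)]; exact softmax_le_one _ _
  have hm : ∀ i, Measurable fun x => softmax (linProc c x) i := fun i =>
    (measurable_softmax i).comp (measurable_linProc c)
  have is : ∀ i, Integrable (fun x => softmax (linProc c x) i) (gaussianPi ι) := fun i =>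
    Integrable.of_bound (hm i).aestronglyMeasurable 1 (Filter.Eventually.of_forall fun x => hs x i)
  have i1 : ∀ i k, Integrable (fun x => c' i k * (x k * softmax (linProc c x) i))
      (gaussianPi ι) := fun i k =>
    ((integrable_eval_gaussianPi k).mul_bdd (c := 1) (hm i).aestronglyMeasurable
      (Filter.Eventually.of_forall fun x => hs x i)).const_mul _
  have i2 : ∀ i k, Integrable (fun x => c' i k * (softmax (linProc c x) i *
      (c i k - ∑ j, softmax (linProc c x) j * c j k))) (gaussianPi ι) := fun i k => by
    refine (Integrable.bdd_mul (c := 1) ?_ (hm i).aestronglyMeasurable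
      (Filter.Eventually.of_forall fun x => hs x i)).const_mul _
    exact (integrable_const _).sub (integrable_finsetSum _ fun j _ => (is j).mul_const _)
  have e1 : ∀ x, ∑ i, softmax (linProc c x) i * linProc c' x i =
      ∑ i, ∑ k, c' i k * (x k * softmax (linProc c x) i) := by
    intro x
    refine Finset.sum_congr rfl fun i _ => ?_
    rw [linProc, Finset.mul_sum]
    exact Finset.sum_congr rfl fun k _ => by ring
  have e2 : ∀ x, ∑ i, softmax (linProc c x) i *
        ((∑ k, c' i k * c i k) - ∑ j, softmax (linProc c x) j * ∑ k, c' i k * c j k) =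
      ∑ i, ∑ k, c' i k * (softmax (linProc c x) i *
        (c i k - ∑ j, softmax (linProc c x) j * c j k)) := by
    intro x
    refine Finset.sum_congr rfl fun i _ => ?_
    have : ∑ j, softmax (linProc c x) j * ∑ k, c' i k * c j k =
        ∑ k, c' i k * ∑ j, softmax (linProc c x) j * c j k := by
      simp_rw [Finset.mul_sum]
      rw [Finset.sum_comm]
      exact Finset.sum_congr rfl fun k _ => Finset.sum_congr rfl fun j _ => by ring
    rw [this, ← Finset.sum_sub_distrib, Finset.mul_sum]
    exact Finset.sum_congr rfl fun k _ => by ring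
  simp_rw [e1, e2]
  rw [integral_finsetSum _ fun i _ => integrable_finsetSum _ fun k _ => i1 i k,
    integral_finsetSum _ fun i _ => integrable_finsetSum _ fun k _ => i2 i k]
  refine Finset.sum_congr rfl fun i _ => ?_
  rw [integral_finsetSum _ fun k _ => i1 i k, integral_finsetSum _ fun k _ => i2 i k]
  refine Finset.sum_congr rfl fun k _ => ?_
  rw [integral_const_mul, integral_const_mul, integral_eval_mul_softmax]

/-- Nonnegative increments of a symmetric matrix `D` force its weighted diagonal to dominate its
weighted off-diagonal part. -/
lemma sum_mul_diag_sub_nonneg {p : I → ℝ} (hp : ∀ i, 0 ≤ p i) (hp1 : ∑ i, p i = 1)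
    {D : I → I → ℝ} (hD : ∀ i j, D i j = D j i) (hinc : ∀ i j, 0 ≤ D i i + D j j - 2 * D i j) :
    0 ≤ ∑ i, p i * (D i i - ∑ j, p j * D i j) := by
  have e1 : ∑ i, p i * (D i i - ∑ j, p j * D i j) = ∑ i, ∑ j, p i * p j * (D i i - D i j) := by
    refine Finset.sum_congr rfl fun i _ => ?_
    have : D i i = ∑ j, p j * D i i := by rw [← Finset.sum_mul, hp1, one_mul]
    conv_lhs => rw [this]
    rw [← Finset.sum_sub_distrib, Finset.mul_sum]
    exact Finset.sum_congr rfl fun j _ => by ring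
  have e2 : ∑ i, ∑ j, p i * p j * (D i i - D i j) = ∑ i, ∑ j, p i * p j * (D j j - D i j) := by
    rw [Finset.sum_comm]
    exact Finset.sum_congr rfl fun i _ => Finset.sum_congr rfl fun j _ => by rw [hD j i]; ring
  have h3 : 0 ≤ ∑ i, ∑ j, p i * p j * (D i i + D j j - 2 * D i j) :=
    Finset.sum_nonneg fun i _ => Finset.sum_nonneg fun j _ =>
      mul_nonneg (mul_nonneg (hp i) (hp j)) (hinc i j)
  have e3 : ∑ i, ∑ j, p i * p j * (D i i + D j j - 2 * D i j) =
      ∑ i, ∑ j, p i * p j * (D i i - D i j) + ∑ i, ∑ j, p i * p j * (D j j - D i j) := by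
    simp_rw [← Finset.sum_add_distrib]
    exact Finset.sum_congr rfl fun i _ => Finset.sum_congr rfl fun j _ => by ring
  linarith

/-- **Sudakov–Fernique comparison** for the log-sum-exp of two linear Gaussian processes whose
coefficients are mutually orthogonal. -/
lemma integral_logSumExp_linProc_le [Nonempty I] (a b : I → ι → ℝ)
    (horth : ∀ i j, ∑ k, a i k * b j k = 0)
    (hinc : ∀ i j, ∑ k, (a i k - a j k) ^ 2 ≤ ∑ k, (b i k - b j k) ^ 2) :
    ∫ x, logSumExp (linProc a x) ∂gaussianPi ι ≤ ∫ x, logSumExp (linProc b x) ∂gaussianPi ι := by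
  set c : ℝ → I → ι → ℝ := fun θ i k => Real.cos θ * a i k + Real.sin θ * b i k with hc
  set c' : ℝ → I → ι → ℝ := fun θ i k => -Real.sin θ * a i k + Real.cos θ * b i k with hc'
  have hcc : ∀ θ i k, HasDerivAt (fun u => c u i k) (c' θ i k) θ := fun θ i k =>
    ((Real.hasDerivAt_cos θ).mul_const _).add ((Real.hasDerivAt_sin θ).mul_const _)
  have hlin : ∀ θ x i, HasDerivAt (fun u => linProc (c u) x i) (linProc (c' θ) x i) θ :=
    fun θ x i => HasDerivAt.fun_sum fun k _ => (hcc θ i k).mul_const _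
  have hs : ∀ (z : I → ℝ) i, |softmax z i| ≤ 1 := fun z i => by
    rw [abs_of_nonneg (softmax_nonneg _ _)]; exact softmax_le_one _ _
  have hderiv : ∀ θ, HasDerivAt (fun u => ∫ x, logSumExp (linProc (c u) x) ∂gaussianPi ι)
      (∫ x, ∑ i, softmax (linProc (c θ) x) i * linProc (c' θ) x i ∂gaussianPi ι) θ := by
    intro θ
    refine (hasDerivAt_integral_of_dominated_loc_of_deriv_le (μ := gaussianPi ι)
      (F := fun u x => logSumExp (linProc (c u) x))
      (F' := fun u x => ∑ i, softmax (linProc (c u) x) i * linProc (c' u) x i)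
      (bound := fun x => ∑ i, ∑ k, (|a i k| + |b i k|) * |x k|) Filter.univ_mem
      ?_ (integrable_logSumExp_linProc _) ?_ ?_ ?_ ?_).2
    · exact Filter.Eventually.of_forall fun u => (integrable_logSumExp_linProc _).1
    · refine (Finset.measurable_fun_sum _ fun i _ => ?_).aestronglyMeasurable
      exact ((measurable_softmax i).comp (measurable_linProc _)).mul
        ((measurable_pi_apply i).comp (measurable_linProc _))
    · refine Filter.Eventually.of_forall fun x u _ => ?_
      refine (Finset.abs_sum_le_sum_abs _ _).trans (Finset.sum_le_sum fun i _ => ?_)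
      rw [abs_mul]
      refine (mul_le_of_le_one_left (abs_nonneg _) (hs _ i)).trans ?_
      refine (Finset.abs_sum_le_sum_abs _ _).trans (Finset.sum_le_sum fun k _ => ?_)
      rw [abs_mul]
      refine mul_le_mul_of_nonneg_right ?_ (abs_nonneg _)
      refine (abs_add_le _ _).trans ?_
      rw [abs_mul, abs_mul, abs_neg]
      exact add_le_add (mul_le_of_le_one_left (abs_nonneg _) (Real.abs_sin_le_one u))
        (mul_le_of_le_one_left (abs_nonneg _) (Real.abs_cos_le_one u))
    · exact integrable_finsetSum _ fun i _ => integrable_finsetSum _ fun k _ =>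
        (integrable_eval_gaussianPi k).abs.const_mul _
    · exact Filter.Eventually.of_forall fun x u _ => hasDerivAt_logSumExp fun i => hlin u x i
  have hnonneg : ∀ θ ∈ Set.Icc 0 (Real.pi / 2),
      0 ≤ ∫ x, ∑ i, softmax (linProc (c θ) x) i * linProc (c' θ) x i ∂gaussianPi ι := by
    intro θ hθ
    rw [integral_sum_softmax_mul_linProc]
    have hsc : 0 ≤ Real.cos θ * Real.sin θ := mul_nonneg
      (Real.cos_nonneg_of_neg_pi_div_two_le_of_le (by linarith [hθ.1, Real.pi_pos]) hθ.2)
      (Real.sin_nonneg_of_nonneg_of_le_pi hθ.1 (by linarith [hθ.2, Real.pi_pos]))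
    have hD : ∀ i j, ∑ k, c' θ i k * c θ j k =
        Real.cos θ * Real.sin θ * (∑ k, b i k * b j k - ∑ k, a i k * a j k) := by
      intro i j
      have : ∀ k, c' θ i k * c θ j k = Real.cos θ * Real.sin θ * (b i k * b j k)
          - Real.cos θ * Real.sin θ * (a i k * a j k) - Real.sin θ ^ 2 * (a i k * b j k)
          + Real.cos θ ^ 2 * (a j k * b i k) := fun k => by simp only [hc, hc']; ring
      simp_rw [this, Finset.sum_add_distrib, Finset.sum_sub_distrib, ← Finset.mul_sum, horth]
      ring
    refine integral_nonneg fun x => ?_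
    refine sum_mul_diag_sub_nonneg (D := fun i j => ∑ k, c' θ i k * c θ j k)
      (softmax_nonneg _) (sum_softmax _) ?_ ?_
    · intro i j
      have h : ∀ d : I → ι → ℝ, ∑ k, d i k * d j k = ∑ k, d j k * d i k := fun d =>
        Finset.sum_congr rfl fun k _ => mul_comm _ _
      simp only [hD]
      rw [h a, h b]
    · intro i j
      have h := hinc i j
      rw [sum_sub_sq, sum_sub_sq] at h
      simp only [hD, ← sq]
      nlinarith [mul_nonneg hsc (sub_nonneg.2 h)]
  have hmono : MonotoneOn (fun u => ∫ x, logSumExp (linProc (c u) x) ∂gaussianPi ι)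
      (Set.Icc 0 (Real.pi / 2)) := by
    refine monotoneOn_of_deriv_nonneg (convex_Icc _ _)
      (fun θ _ => (hderiv θ).continuousAt.continuousWithinAt)
      (fun θ _ => (hderiv θ).differentiableAt.differentiableWithinAt) ?_
    intro θ hθ
    rw [(hderiv θ).deriv]
    exact hnonneg θ (interior_subset hθ)
  have hpi : (0 : ℝ) ≤ Real.pi / 2 := by positivity
  have h := hmono (Set.left_mem_Icc.2 hpi) (Set.right_mem_Icc.2 hpi) hpi
  simpa [hc] using h

end SudakovFernique

section Chevet

variable {n N : ℕ}

/-- Index type of a Gaussian matrix together with two Gaussian vectors. -/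
abbrev ChevetIndex (n N : ℕ) : Type := (Fin n × Fin N) ⊕ (Fin n ⊕ Fin N)

/-- The bilinear form `⟨u, A v⟩`. -/
def bilin (A : Fin n → Fin N → ℝ) (u : Fin n → ℝ) (v : Fin N → ℝ) : ℝ :=
  ∑ p : Fin n × Fin N, u p.1 * v p.2 * A p.1 p.2

lemma measurePreserving_pi_comp_inl {ι κ : Type*} [Fintype ι] [Fintype κ] :
    MeasurePreserving (fun (x : ι ⊕ κ → ℝ) i => x (Sum.inl i)) (gaussianPi (ι ⊕ κ))
      (gaussianPi ι) := by
  have hm : Measurable (fun (x : ι ⊕ κ → ℝ) i => x (Sum.inl i)) := by fun_prop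
  refine ⟨hm, (Measure.pi_eq fun s hs => ?_).symm⟩
  rw [Measure.map_apply hm (MeasurableSet.univ_pi hs)]
  have : (fun (x : ι ⊕ κ → ℝ) i => x (Sum.inl i)) ⁻¹' (Set.univ.pi s) =
      Set.univ.pi (Sum.elim s fun _ => Set.univ) := by
    ext x
    simp
  rw [this, Measure.pi_pi, Fintype.prod_sum_type]
  simp

lemma measurePreserving_matrix {κ : Type*} [Fintype κ] :
    MeasurePreserving (fun (x : (Fin n × Fin N) ⊕ κ → ℝ) i j => x (Sum.inl (i, j)))
      (gaussianPi _) (gaussianMatrixMeasure n N) := by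
  have h : MeasurePreserving (MeasurableEquiv.curry (Fin n) (Fin N) ℝ) (gaussianPi (Fin n × Fin N))
      (gaussianMatrixMeasure n N) := by
    refine ⟨MeasurableEquiv.measurable _, ?_⟩
    have := Measure.infinitePi_map_curry (fun (_ : Fin n) (_ : Fin N) => gaussianReal 0 1)
    simp only [Measure.infinitePi_eq_pi] at this
    exact this
  exact h.comp measurePreserving_pi_comp_inl

lemma sum_sq_sub_mul_le {α β : Type*} [Fintype α] [Fintype β] {u u' : α → ℝ} {v v' : β → ℝ}
    (hu : ∑ k, u k ^ 2 ≤ 1) (hu' : ∑ k, u' k ^ 2 ≤ 1) (hv : ∑ k, v k ^ 2 = 1)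
    (hv' : ∑ k, v' k ^ 2 = 1) :
    ∑ p : α × β, (u p.1 * v p.2 - u' p.1 * v' p.2) ^ 2 ≤
      ∑ k, (u k - u' k) ^ 2 + ∑ k, (v k - v' k) ^ 2 := by
  have hprod : ∀ (w : α → ℝ) (w' : β → ℝ), ∑ p : α × β, w p.1 * w' p.2 =
      (∑ k, w k) * ∑ k, w' k := by
    intro w w'
    rw [Fintype.sum_prod_type, Finset.sum_mul_sum]
  have e1 : ∑ p : α × β, (u p.1 * v p.2 - u' p.1 * v' p.2) ^ 2 =
      (∑ k, u k ^ 2) * (∑ k, v k ^ 2) + (∑ k, u' k ^ 2) * (∑ k, v' k ^ 2)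
        - 2 * ((∑ k, u k * u' k) * ∑ k, v k * v' k) := by
    rw [← hprod (fun k => u k ^ 2) (fun k => v k ^ 2),
      ← hprod (fun k => u' k ^ 2) (fun k => v' k ^ 2),
      ← hprod (fun k => u k * u' k) (fun k => v k * v' k),
      Finset.mul_sum, ← Finset.sum_add_distrib, ← Finset.sum_sub_distrib]
    exact Finset.sum_congr rfl fun p _ => by ring
  have hP : 0 ≤ ∑ k, (u k - u' k) ^ 2 := Finset.sum_nonneg fun k _ => sq_nonneg _
  have hQ : 0 ≤ ∑ k, (v k - v' k) ^ 2 := Finset.sum_nonneg fun k _ => sq_nonneg _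
  rw [sum_sub_sq] at hP hQ
  rw [e1, sum_sub_sq, sum_sub_sq, hv, hv']
  rw [hv, hv'] at hQ
  nlinarith [mul_nonneg (show 0 ≤ 1 - ∑ k, u k * u' k by linarith)
    (show 0 ≤ 1 - ∑ k, v k * v' k by linarith)]

/-- Softmax form of **Chevet's inequality**. -/
lemma integral_logSumExp_bilin_le {I : Type*} [Fintype I] [Nonempty I] (β : ℝ)
    (u : I → Fin n → ℝ) (v : I → Fin N → ℝ) (hu : ∀ i, ∑ k, u i k ^ 2 ≤ 1)
    (hv : ∀ i, ∑ k, v i k ^ 2 = 1) :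
    Integrable (fun A => logSumExp fun i => β * bilin A (u i) (v i))
      (gaussianMatrixMeasure n N) ∧
    Integrable (fun x : ChevetIndex n N → ℝ => logSumExp fun i =>
      β * (∑ k, u i k * x (Sum.inr (Sum.inl k)) + ∑ k, v i k * x (Sum.inr (Sum.inr k))))
      (gaussianPi (ChevetIndex n N)) ∧
    ∫ A, logSumExp (fun i => β * bilin A (u i) (v i)) ∂gaussianMatrixMeasure n N ≤
      ∫ x, logSumExp (fun i => β * (∑ k, u i k * x (Sum.inr (Sum.inl k)) +
        ∑ k, v i k * x (Sum.inr (Sum.inr k)))) ∂gaussianPi (ChevetIndex n N) := by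
  set a : I → ChevetIndex n N → ℝ := fun i =>
    Sum.elim (fun p => β * (u i p.1 * v i p.2)) (fun _ => 0) with ha
  set b : I → ChevetIndex n N → ℝ := fun i =>
    Sum.elim (fun _ => 0) (Sum.elim (fun k => β * u i k) (fun k => β * v i k)) with hb
  have hA : ∀ x : ChevetIndex n N → ℝ, linProc a x =
      fun i => β * bilin (fun i j => x (Sum.inl (i, j))) (u i) (v i) := by
    intro x; ext i
    simp only [linProc, ha, bilin, Fintype.sum_sum_type, Sum.elim_inl, Sum.elim_inr, zero_mul,
      Finset.sum_const_zero, add_zero, Finset.mul_sum, mul_assoc]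
  have hB : ∀ x : ChevetIndex n N → ℝ, linProc b x =
      fun i => β * (∑ k, u i k * x (Sum.inr (Sum.inl k)) +
        ∑ k, v i k * x (Sum.inr (Sum.inr k))) := by
    intro x; ext i
    simp only [linProc, hb, Fintype.sum_sum_type, Sum.elim_inl, Sum.elim_inr, zero_mul,
      Finset.sum_const_zero, zero_add, Finset.mul_sum, mul_assoc, mul_add]
  have h := integral_logSumExp_linProc_le a b (by intro i j; simp [ha, hb]) (by
    intro i j
    simp only [ha, hb, Fintype.sum_sum_type, Sum.elim_inl, Sum.elim_inr, ← mul_sub, mul_pow,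
      ← Finset.mul_sum, sub_self, ← mul_add]
    simp only [ne_eq, OfNat.ofNat_ne_zero, not_false_eq_true, zero_pow, Finset.sum_const_zero,
      add_zero, zero_add]
    exact mul_le_mul_of_nonneg_left (sum_sq_sub_mul_le (hu i) (hu j) (hv i) (hv j))
      (sq_nonneg β))
  have iA := integrable_logSumExp_linProc a
  have iB := integrable_logSumExp_linProc b
  simp only [hA] at h iA
  simp only [hB] at h iB
  have mp := measurePreserving_matrix (n := n) (N := N) (κ := Fin n ⊕ Fin N)
  have hmeas : Measurable (fun A : Fin n → Fin N → ℝ =>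
      logSumExp fun i => β * bilin A (u i) (v i)) := by
    refine measurable_logSumExp.comp (measurable_pi_iff.2 fun i => ?_)
    unfold bilin
    fun_prop
  refine ⟨(mp.integrable_comp hmeas.aestronglyMeasurable).1 iA, iB, ?_⟩
  rw [← mp.map_eq, integral_map mp.measurable.aemeasurable hmeas.aestronglyMeasurable]
  exact h

lemma abs_bilin_sub_le (A : Fin n → Fin N → ℝ) {u u' : Fin n → ℝ} {v v' : Fin N → ℝ} {ε : ℝ}
    (hu' : ∀ k, |u' k| ≤ 1) (hv : ∀ k, |v k| ≤ 1) (hε : ∀ k, |u k - u' k| ≤ ε)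
    (hε' : ∀ k, |v k - v' k| ≤ ε) :
    bilin A u v ≤ bilin A u' v' + 2 * ε * ∑ p : Fin n × Fin N, |A p.1 p.2| := by
  unfold bilin
  rw [Finset.mul_sum, ← Finset.sum_add_distrib]
  refine Finset.sum_le_sum fun p _ => ?_
  have h1 : |(u p.1 - u' p.1) * v p.2 + u' p.1 * (v p.2 - v' p.2)| ≤ 2 * ε := by
    refine (abs_add_le _ _).trans ?_
    rw [abs_mul, abs_mul]
    have := mul_le_of_le_one_right (abs_nonneg (u p.1 - u' p.1)) (hv p.2)
    have := mul_le_of_le_one_left (abs_nonneg (v p.2 - v' p.2)) (hu' p.1)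
    linarith [hε p.1, hε' p.2]
  have h2 : ((u p.1 - u' p.1) * v p.2 + u' p.1 * (v p.2 - v' p.2)) * A p.1 p.2 ≤
      2 * ε * |A p.1 p.2| := by
    refine (le_abs_self _).trans ?_
    rw [abs_mul]
    exact mul_le_mul_of_nonneg_right h1 (abs_nonneg _)
  linarith

lemma exists_bilin_eq_sqrt_normSqMulVec (A : Fin n → Fin N → ℝ) (v : Fin N → ℝ) :
    ∃ u : Fin n → ℝ, ∑ k, u k ^ 2 ≤ 1 ∧ bilin A u v = Real.sqrt (normSqMulVec A v) := by
  set r := Real.sqrt (normSqMulVec A v) with hr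
  have h0 : 0 ≤ normSqMulVec A v := Finset.sum_nonneg fun _ _ => sq_nonneg _
  have hr2 : r ^ 2 = normSqMulVec A v := Real.sq_sqrt h0
  refine ⟨fun k => (∑ j, A k j * v j) / r, ?_, ?_⟩
  · simp_rw [div_pow, ← Finset.sum_div]
    rw [hr2]
    exact div_self_le_one _
  · have : bilin A (fun k => (∑ j, A k j * v j) / r) v = normSqMulVec A v / r := by
      unfold bilin normSqMulVec
      rw [Fintype.sum_prod_type, Finset.sum_div]
      refine Finset.sum_congr rfl fun k _ => ?_
      have : ∑ j, (∑ j, A k j * v j) / r * v j * A k j =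
          (∑ j, A k j * v j) / r * ∑ j, A k j * v j := by
        rw [Finset.mul_sum]
        exact Finset.sum_congr rfl fun j _ => by ring
      simp only [this]
      ring
    rw [this, ← hr2, sq, mul_self_div_self]

lemma abs_le_one_of_sum_sq_le_one {ι : Type*} [Fintype ι] {u : ι → ℝ} (h : ∑ k, u k ^ 2 ≤ 1)
    (k : ι) : |u k| ≤ 1 := by
  rw [← sq_le_one_iff_abs_le_one]
  exact (Finset.single_le_sum (f := fun k => u k ^ 2) (fun _ _ => sq_nonneg _)
    (Finset.mem_univ k)).trans h

/-- **Chevet's inequality** for the unit ball against a set of unit vectors, with the supremum of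
the second Gaussian process replaced by an integrable majorant `M`. -/
lemma integral_sSup_sqrt_normSqMulVec_le {S : Set (Fin N → ℝ)} (hS : S.Nonempty)
    (hS1 : ∀ v ∈ S, ∑ j, v j ^ 2 = 1) {M : (ChevetIndex n N → ℝ) → ℝ}
    (hMi : Integrable M (gaussianPi (ChevetIndex n N)))
    (hM : ∀ x, ∀ u : Fin n → ℝ, ∑ k, u k ^ 2 ≤ 1 → ∀ v ∈ S,
      ∑ k, u k * x (Sum.inr (Sum.inl k)) + ∑ k, v k * x (Sum.inr (Sum.inr k)) ≤ M x) :
    ∫ A, sSup ((fun v => Real.sqrt (normSqMulVec A v)) '' S) ∂gaussianMatrixMeasure n N ≤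
      ∫ x, M x ∂gaussianPi (ChevetIndex n N) := by
  have : IsProbabilityMeasure (gaussianMatrixMeasure n N) := by
    unfold gaussianMatrixMeasure; infer_instance
  set W : (Fin n → Fin N → ℝ) → ℝ := fun A => ∑ p : Fin n × Fin N, |A p.1 p.2| with hW
  have hWi : Integrable W (gaussianMatrixMeasure n N) := by
    have mp := measurePreserving_matrix (n := n) (N := N) (κ := Fin 0)
    refine (mp.integrable_comp (by fun_prop)).1 ?_
    exact integrable_finsetSum _ fun p _ => (integrable_eval_gaussianPi (Sum.inl p)).abs
  have hW0 : 0 ≤ ∫ A, W A ∂gaussianMatrixMeasure n N :=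
    integral_nonneg fun A => Finset.sum_nonneg fun _ _ => abs_nonneg _
  set D := ∫ A, W A ∂gaussianMatrixMeasure n N with hD
  refine le_of_forall_pos_le_add fun δ hδ => ?_
  set ε := δ / (4 * (D + 1)) with hε
  have hε0 : 0 < ε := by positivity
  set K : Set ((Fin n → ℝ) × (Fin N → ℝ)) := {u | ∑ k, u k ^ 2 ≤ 1} ×ˢ S with hK
  have hKtb : TotallyBounded K := by
    refine (isCompact_closedBall (0 : (Fin n → ℝ) × (Fin N → ℝ)) 1).totallyBounded.subset
      fun p hp => ?_
    rw [mem_closedBall_zero_iff, Prod.norm_def, max_le_iff, pi_norm_le_iff_of_nonneg zero_le_one,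
      pi_norm_le_iff_of_nonneg zero_le_one]
    exact ⟨abs_le_one_of_sum_sq_le_one hp.1, abs_le_one_of_sum_sq_le_one (hS1 _ hp.2).le⟩
  obtain ⟨I, hIK, hIfin, hIcov⟩ := Metric.finite_approx_of_totallyBounded hKtb ε hε0
  obtain ⟨v₀, hv₀⟩ := hS
  have hcov : ∀ p ∈ K, ∃ q : I, dist p q.1 < ε := by
    intro p hp
    obtain ⟨q, hq, hpq⟩ := Set.mem_iUnion₂.1 (hIcov hp)
    exact ⟨⟨q, hq⟩, hpq⟩
  have : Fintype I := hIfin.fintype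
  have : Nonempty I := by
    obtain ⟨q, -⟩ := hcov (0, v₀) ⟨by simp, hv₀⟩
    exact ⟨q⟩
  set c := Real.log (Fintype.card I) with hcdef
  have hc : 0 ≤ c := Real.log_natCast_nonneg _
  set β := 2 * (c + 1) / δ with hβ
  have hβ0 : 0 < β := by positivity
  obtain ⟨iA, iB, hle⟩ := integral_logSumExp_bilin_le (I := I) β (fun i => i.1.1) (fun i => i.1.2)
    (fun i => (hIK i.2).1) (fun i => hS1 _ (hIK i.2).2)
  have hpt : ∀ A, sSup ((fun v => Real.sqrt (normSqMulVec A v)) '' S) ≤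
      β⁻¹ * logSumExp (fun i : I => β * bilin A i.1.1 i.1.2) + 2 * ε * W A := by
    intro A
    refine csSup_le ⟨_, v₀, hv₀, rfl⟩ ?_
    rintro _ ⟨v, hv, rfl⟩
    obtain ⟨u, hu, huv⟩ := exists_bilin_eq_sqrt_normSqMulVec A v
    obtain ⟨q, hq⟩ := hcov (u, v) ⟨hu, hv⟩
    rw [Prod.dist_eq, max_lt_iff] at hq
    simp only [← huv]
    refine (abs_bilin_sub_le A (u' := q.1.1) (v' := q.1.2) (ε := ε)
      (abs_le_one_of_sum_sq_le_one (hIK q.2).1)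
      (abs_le_one_of_sum_sq_le_one (hS1 v hv).le)
      (fun k => (dist_le_pi_dist _ _ k).trans hq.1.le)
      (fun k => (dist_le_pi_dist _ _ k).trans hq.2.le)).trans ?_
    gcongr
    rw [le_inv_mul_iff₀ hβ0]
    exact le_logSumExp (fun i : I => β * bilin A i.1.1 i.1.2) q
  calc ∫ A, sSup ((fun v => Real.sqrt (normSqMulVec A v)) '' S) ∂gaussianMatrixMeasure n N
      ≤ ∫ A, (β⁻¹ * logSumExp (fun i : I => β * bilin A i.1.1 i.1.2) + 2 * ε * W A)
          ∂gaussianMatrixMeasure n N := by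
        refine integral_mono_of_nonneg (Filter.Eventually.of_forall fun A => ?_)
          ((iA.const_mul _).add (hWi.const_mul _)) (Filter.Eventually.of_forall hpt)
        refine Real.sSup_nonneg ?_
        rintro _ ⟨v, -, rfl⟩
        exact Real.sqrt_nonneg _
    _ = β⁻¹ * (∫ A, logSumExp (fun i : I => β * bilin A i.1.1 i.1.2) ∂gaussianMatrixMeasure n N)
          + 2 * ε * D := by
        rw [integral_add (iA.const_mul _) (hWi.const_mul _), integral_const_mul,
          integral_const_mul]
    _ ≤ β⁻¹ * (β * (∫ x, M x ∂gaussianPi (ChevetIndex n N)) + c) + 2 * ε * D := by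
        gcongr
        refine hle.trans ?_
        have : ∫ x, (β * M x + c) ∂gaussianPi (ChevetIndex n N) =
            β * (∫ x, M x ∂gaussianPi (ChevetIndex n N)) + c := by
          rw [integral_add (hMi.const_mul _) (integrable_const _), integral_const_mul]
          simp
        rw [← this]
        refine integral_mono iB ((hMi.const_mul _).add (integrable_const _)) fun x => ?_
        exact logSumExp_le fun i => mul_le_mul_of_nonneg_left
          (hM x _ (hIK i.2).1 _ (hIK i.2).2) hβ0.le
    _ ≤ (∫ x, M x ∂gaussianPi (ChevetIndex n N)) + δ := by
        have h1 : β⁻¹ * (β * (∫ x, M x ∂gaussianPi (ChevetIndex n N)) + c) =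
            (∫ x, M x ∂gaussianPi (ChevetIndex n N)) + c / (2 * (c + 1)) * δ := by
          rw [hβ]; field_simp
        have h2 : 2 * ε * D = D / (2 * (D + 1)) * δ := by
          rw [hε]; field_simp; ring
        have h3 : c / (2 * (c + 1)) ≤ 1 / 2 := by
          rw [div_le_div_iff₀ (by positivity) two_pos]; linarith
        have h4 : D / (2 * (D + 1)) ≤ 1 / 2 := by
          rw [div_le_div_iff₀ (by positivity) two_pos]; linarith
        rw [h1, h2]
        nlinarith

end Chevet

section SparseSup

lemma integrable_sq_gaussianReal : Integrable (fun x : ℝ => x ^ 2) (gaussianReal 0 1) :=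
  (memLp_id_gaussianReal (μ := 0) (v := 1) 2).integrable_sq

lemma integral_sq_gaussianReal : ∫ x, x ^ 2 ∂gaussianReal 0 1 = 1 := by
  have h := variance_of_integral_eq_zero (μ := gaussianReal 0 1) (X := fun x : ℝ => x)
    aemeasurable_id (by simp [integral_id_gaussianReal])
  rw [variance_fun_id_gaussianReal] at h
  simpa using h.symm

lemma integral_sqrt_le_sqrt_integral {Ω : Type*} [MeasurableSpace Ω] {P : Measure Ω}
    [IsProbabilityMeasure P] {f : Ω → ℝ} (hf : Integrable f P) (h0 : ∀ x, 0 ≤ f x) :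
    Integrable (fun x => Real.sqrt (f x)) P ∧
      ∫ x, Real.sqrt (f x) ∂P ≤ Real.sqrt (∫ x, f x ∂P) := by
  have hi : Integrable (fun x => Real.sqrt (f x)) P := by
    refine Integrable.mono' ((integrable_const 1).add hf)
      (Real.continuous_sqrt.comp_aestronglyMeasurable hf.1) (Filter.Eventually.of_forall fun x => ?_)
    rw [Real.norm_of_nonneg (Real.sqrt_nonneg _)]
    simp only [Pi.add_apply]
    nlinarith [Real.sq_sqrt (h0 x), sq_nonneg (Real.sqrt (f x) - 1)]
  exact ⟨hi, Real.strictConcaveOn_sqrt.concaveOn.le_map_integral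
    Real.continuous_sqrt.continuousOn isClosed_Ici (Filter.Eventually.of_forall h0) hf hi⟩

lemma nonneg_of_chiSq1_Ioi_lt_one {t : ℝ} (h : chiSq1 (Set.Ioi t) < 1) : 0 ≤ t := by
  by_contra ht
  push Not at ht
  have : chiSq1 (Set.Ioi t) = 1 := by
    rw [chiSq1, Measure.map_apply (by fun_prop) measurableSet_Ioi]
    have : (fun x : ℝ => x ^ 2) ⁻¹' Set.Ioi t = Set.univ :=
      Set.eq_univ_of_forall fun x => ht.trans_le (sq_nonneg x)
    rw [this, measure_univ]
  rw [this] at h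
  exact lt_irrefl _ h

lemma integrable_max_sq_sub (t : ℝ) :
    Integrable (fun x : ℝ => max (x ^ 2 - t) 0) (gaussianReal 0 1) :=
  (integrable_sq_gaussianReal.sub (integrable_const t)).pos_part

lemma integral_max_sq_sub {t p : ℝ} (hp : 0 < p) (h : chiSq1 (Set.Ioi t) = ENNReal.ofReal p) :
    ∫ x, max (x ^ 2 - t) 0 ∂gaussianReal 0 1 = p * condExpGt t - t * p := by
  have hreal : (chiSq1 (Set.Ioi t)).toReal = p := by rw [h, ENNReal.toReal_ofReal hp.le]
  have hid : Integrable (fun y : ℝ => y) chiSq1 := by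
    rw [chiSq1, integrable_map_measure (by fun_prop) (by fun_prop)]
    exact integrable_sq_gaussianReal
  have hfin : IsProbabilityMeasure chiSq1 := by
    unfold chiSq1; exact Measure.isProbabilityMeasure_map (by fun_prop)
  have e : ∫ x, max (x ^ 2 - t) 0 ∂gaussianReal 0 1 = ∫ y, max (y - t) 0 ∂chiSq1 := by
    rw [chiSq1, integral_map (by fun_prop) (by fun_prop)]
  have e2 : ∫ y, max (y - t) 0 ∂chiSq1 = ∫ y in Set.Ioi t, (y - t) ∂chiSq1 := by
    rw [← integral_indicator measurableSet_Ioi]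
    congr 1; ext y
    by_cases hy : t < y
    · rw [Set.indicator_of_mem (Set.mem_Ioi.2 hy), max_eq_left (by linarith)]
    · rw [Set.indicator_of_notMem (by simpa using hy), max_eq_right (by linarith)]
  rw [e, e2, integral_sub hid.integrableOn (integrable_const _), condExpGt, hreal,
    mul_div_cancel₀ _ hp.ne']
  simp [measureReal_def, hreal, mul_comm]

lemma sum_mul_le_sqrt_of_mem_sparseUnitVecs {N s : ℕ} {v : Fin N → ℝ} (hv : v ∈ sparseUnitVecs N s)
    {t : ℝ} (ht : 0 ≤ t) (h : Fin N → ℝ) :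
    ∑ j, v j * h j ≤ Real.sqrt (s * t + ∑ j, max (h j ^ 2 - t) 0) := by
  classical
  set S := Finset.univ.filter fun j => v j ≠ 0 with hS
  have hsub : ∀ f : Fin N → ℝ, (∀ j, v j = 0 → f j = 0) → ∑ j, f j = ∑ j ∈ S, f j := by
    intro f hf
    refine (Finset.sum_subset (Finset.subset_univ S) fun j _ hj => hf j ?_).symm
    simpa [hS] using hj
  rw [hsub _ fun j hj => by rw [hj, zero_mul]]
  refine (Real.sum_mul_le_sqrt_mul_sqrt S v h).trans ?_
  rw [← hsub (fun j => v j ^ 2) fun j hj => by simp [hj], hv.1, Real.sqrt_one, one_mul]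
  refine Real.sqrt_le_sqrt ?_
  calc ∑ j ∈ S, h j ^ 2 ≤ ∑ j ∈ S, (t + max (h j ^ 2 - t) 0) :=
        Finset.sum_le_sum fun j _ => by linarith [le_max_left (h j ^ 2 - t) 0]
    _ = S.card * t + ∑ j ∈ S, max (h j ^ 2 - t) 0 := by
        rw [Finset.sum_add_distrib, Finset.sum_const, nsmul_eq_mul]
    _ ≤ s * t + ∑ j, max (h j ^ 2 - t) 0 := by
        refine add_le_add (mul_le_mul_of_nonneg_right (by exact_mod_cast hv.2) ht) ?_
        exact Finset.sum_le_sum_of_subset_of_nonneg (Finset.subset_univ _)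
          fun _ _ _ => le_max_right _ _

/-- The comparison inequality without the lower-order term. -/
lemma integral_sigmaMax_le {n N s : ℕ} {t : ℝ} (hs : 0 < s) (hsN : (s : ℝ) / N < 1)
    (ht : chiSq1 (Set.Ioi t) = ENNReal.ofReal ((s : ℝ) / N)) :
    ∫ A, sigmaMax n N s A ∂gaussianMatrixMeasure n N ≤
      Real.sqrt n + Real.sqrt s * Real.sqrt (condExpGt t) := by
  rcases Nat.eq_zero_or_pos N with rfl | hN
  · have : ∀ A, sigmaMax n 0 s A = 0 := by
      intro A
      have : sparseUnitVecs 0 s = ∅ := by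
        ext x; simp [sparseUnitVecs]
      simp [sigmaMax, this]
    simp only [this, integral_zero]
    positivity
  have hN' : (0 : ℝ) < N := by exact_mod_cast hN
  have hs' : (0 : ℝ) < s := by exact_mod_cast hs
  have ht0 : 0 ≤ t := by
    refine nonneg_of_chiSq1_Ioi_lt_one ?_
    rw [ht]
    exact ENNReal.ofReal_lt_one.2 hsN
  set f : (ChevetIndex n N → ℝ) → ℝ := fun x => ∑ k : Fin n, x (Sum.inr (Sum.inl k)) ^ 2 with hf
  set g : (ChevetIndex n N → ℝ) → ℝ := fun x =>
    s * t + ∑ j : Fin N, max (x (Sum.inr (Sum.inr j)) ^ 2 - t) 0 with hg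
  have mp := fun k : ChevetIndex n N =>
    measurePreserving_eval (fun _ : ChevetIndex n N => gaussianReal 0 1) k
  have tr : ∀ (φ : ℝ → ℝ), Measurable φ → ∀ k, ∫ x, φ (x k) ∂gaussianPi (ChevetIndex n N) =
      ∫ y, φ y ∂gaussianReal 0 1 := by
    intro φ hφ k
    rw [← (mp k).map_eq, integral_map (mp k).measurable.aemeasurable hφ.aestronglyMeasurable]
  have if' : ∀ k, Integrable (fun x : ChevetIndex n N → ℝ => x k ^ 2) (gaussianPi _) := fun k =>
    (mp k).integrable_comp_of_integrable integrable_sq_gaussianReal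
  have ig' : ∀ k, Integrable (fun x : ChevetIndex n N → ℝ => max (x k ^ 2 - t) 0)
      (gaussianPi _) := fun k =>
    (mp k).integrable_comp_of_integrable (integrable_max_sq_sub t)
  have hfi : Integrable f (gaussianPi _) := integrable_finsetSum _ fun k _ => if' _
  have hgi : Integrable g (gaussianPi _) :=
    (integrable_const _).add (integrable_finsetSum _ fun k _ => ig' _)
  have hfE : ∫ x, f x ∂gaussianPi _ = n := by
    simp only [hf]
    rw [integral_finsetSum _ fun k _ => if' _]
    simp [tr (fun y => y ^ 2) (by fun_prop), integral_sq_gaussianReal]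
  have hgE : ∫ x, g x ∂gaussianPi _ = s * condExpGt t := by
    simp only [hg]
    rw [integral_add (integrable_const _) (integrable_finsetSum _ fun k _ => ig' _),
      integral_finsetSum _ fun k _ => ig' _]
    simp only [tr (fun y => max (y ^ 2 - t) 0) (by fun_prop),
      integral_max_sq_sub (div_pos hs' hN') ht]
    simp
    field_simp
    ring
  obtain ⟨if1, if2⟩ := integral_sqrt_le_sqrt_integral hfi
    fun x => Finset.sum_nonneg fun _ _ => sq_nonneg _
  obtain ⟨ig1, ig2⟩ := integral_sqrt_le_sqrt_integral hgi
    fun x => add_nonneg (mul_nonneg hs'.le ht0) (Finset.sum_nonneg fun _ _ => le_max_right _ _)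
  have hne : (sparseUnitVecs N s).Nonempty := by
    refine ⟨Pi.single ⟨0, hN⟩ 1, ?_, ?_⟩
    · simp [Pi.single_apply]
    · refine le_trans ?_ hs
      refine Finset.card_le_one.2 fun a ha b hb => ?_
      simp only [Finset.mem_filter, Pi.single_apply] at ha hb
      by_contra hab
      simp_all
  have key := integral_sSup_sqrt_normSqMulVec_le (n := n) hne (fun v hv => hv.1)
    (if1.add ig1) (fun x u hu v hv => by
      refine add_le_add ?_ (sum_mul_le_sqrt_of_mem_sparseUnitVecs hv ht0 _)
      refine (Real.sum_mul_le_sqrt_mul_sqrt _ _ _).trans ?_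
      exact mul_le_of_le_one_left (Real.sqrt_nonneg _) (Real.sqrt_le_one.2 hu))
  simp only [Pi.add_apply] at key
  rw [integral_add if1 ig1] at key
  rw [hfE] at if2
  rw [hgE, Real.sqrt_mul hs'.le] at ig2
  exact key.trans (add_le_add if2 ig2)

end SparseSup

/-- **Upper bound on `E σ_max^s(A)`.**  There is a universal constant `C > 0` such that for a
Gaussian `n × N` random matrix `A` and sparsity `s` with `s/N < 1/5`,
`E σ_max^s(A) ≤ √n + √s·T + C/√(log(N/s))`, where `T = √(E(Y | Y > t))`, `Y ~ χ²₁` and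
`P(Y > t) = s/N`. -/
theorem expectation_sigmaMax_upper_bound :
    ∃ C : ℝ, 0 < C ∧
      ∀ (n N s : ℕ) (t T : ℝ), 0 < s → (s : ℝ) / N < 1 / 5 →
        chiSq1 (Set.Ioi t) = ENNReal.ofReal ((s : ℝ) / N) →
        T = Real.sqrt (condExpGt t) →
        (∫ A, sigmaMax n N s A ∂gaussianMatrixMeasure n N) ≤
          Real.sqrt n + Real.sqrt s * T + C / Real.sqrt (Real.log ((N : ℝ) / s)) := by
  refine ⟨1, one_pos, fun n N s t T hs hsN ht hT => ?_⟩
  have h := integral_sigmaMax_le (n := n) hs (hsN.trans (by norm_num)) ht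
  have h0 : 0 ≤ 1 / Real.sqrt (Real.log ((N : ℝ) / s)) := by positivity
  rw [hT]
  linarith
end
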